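/- For all integers p ≥ 1, 1 ≤ j ≤ 2^p and n ≥ 2^{p+1} − 1, one has H(n, 2^{p+1} − 2 + j) ≥ (p+1)n/2 − ((p+4)·2^{p−1} − (p+1)). -/

import Mathlib

open Filter Polynomial

/-- `Γ` is a periodic orbit of the planar vector field `V`: the image of a
nonconstant periodic solution of `γ' = V ∘ γ`. -/
def IsPeriodicOrbit (V : ℝ × ℝ → ℝ × ℝ) (Γ : Set (ℝ × ℝ)) : Prop :=
  ∃ γ : ℝ → ℝ × ℝ,
    (∀ t : ℝ, HasDerivAt γ (V (γ t)) t) ∧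
    (∃ T : ℝ, 0 < T ∧ Function.Periodic γ T) ∧
    (∃ t₁ t₂ : ℝ, γ t₁ ≠ γ t₂) ∧
    Γ = Set.range γ

/-- `Γ` is a limit cycle of `V`: a periodic orbit which is isolated among
periodic orbits. -/
def IsLimitCycle (V : ℝ × ℝ → ℝ × ℝ) (Γ : Set (ℝ × ℝ)) : Prop :=
  IsPeriodicOrbit V Γ ∧
  ∃ U : Set (ℝ × ℝ), IsOpen U ∧ Γ ⊆ U ∧
    ∀ Γ' : Set (ℝ × ℝ), IsPeriodicOrbit V Γ' → Γ' ⊆ U → Γ' = Γ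

/-- The Liénard vector field `ẋ = y, ẏ = -g(x) - ε f(x) y`. -/
def lienard (f g : Polynomial ℝ) (ε : ℝ) : ℝ × ℝ → ℝ × ℝ :=
  fun p => (p.2, -(g.eval p.1) - ε * (f.eval p.1) * p.2)

/-- `HGe n m c` formalizes `H(n,m) ≥ c`: there are polynomials `f, g` with
`deg f ≤ n`, `deg g ≤ m` and `ε₀ > 0` such that for every `0 < ε ≤ ε₀` the
Liénard system has at least `c` pairwise distinct limit cycles. -/
def HGe (n m : ℕ) (c : ℝ) : Prop :=
  ∃ f g : Polynomial ℝ, f.natDegree ≤ n ∧ g.natDegree ≤ m ∧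
    ∃ ε₀ : ℝ, 0 < ε₀ ∧ ∀ ε : ℝ, 0 < ε → ε ≤ ε₀ →
      ∃ S : Finset (Set (ℝ × ℝ)),
        (∀ Γ ∈ S, IsLimitCycle (lienard f g ε) Γ) ∧ c ≤ (S.card : ℝ)

open Set Topology MeasureTheory

/-- Derivative of `R (θ, E, ε)` with respect to `E`. -/
noncomputable def partialE (R : ℝ × ℝ × ℝ → ℝ) (p : ℝ × ℝ × ℝ) : ℝ :=
  deriv (fun e => R (p.1, e, p.2.2)) p.2.1

theorem ContDiffAt.hasDerivAt_partialE {R : ℝ × ℝ × ℝ → ℝ} {p : ℝ × ℝ × ℝ}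
    (h : ContDiffAt ℝ 1 R p) :
    HasDerivAt (fun e => R (p.1, e, p.2.2)) (partialE R p) p.2.1 ∧
      partialE R p = fderiv ℝ R p (0, 1, 0) := by
  have h1 : HasFDerivAt R (fderiv ℝ R p) p := (h.differentiableAt one_ne_zero).hasFDerivAt
  have h2 : HasDerivAt (fun e : ℝ => ((p.1, e, p.2.2) : ℝ × ℝ × ℝ)) (0, 1, 0) p.2.1 :=
    (hasDerivAt_const _ _).prodMk ((hasDerivAt_id _).prodMk (hasDerivAt_const _ _))
  have h3 : HasDerivAt (fun e => R (p.1, e, p.2.2)) (fderiv ℝ R p (0, 1, 0)) p.2.1 :=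
    HasFDerivAt.comp_hasDerivAt (l := R) (f := fun e : ℝ => ((p.1, e, p.2.2) : ℝ × ℝ × ℝ))
      p.2.1 h1 h2
  have h4 : partialE R p = fderiv ℝ R p (0, 1, 0) := h3.deriv
  exact ⟨h4 ▸ h3, h4⟩

theorem ContDiffAt.continuousAt_partialE {R : ℝ × ℝ × ℝ → ℝ} {p : ℝ × ℝ × ℝ}
    (h : ContDiffAt ℝ 1 R p) : ContinuousAt (partialE R) p := by
  have h1 : ContinuousAt (fun q => fderiv ℝ R q (0, 1, 0)) p :=
    (h.continuousAt_fderiv one_ne_zero).clm_apply continuousAt_const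
  refine h1.congr ?_
  filter_upwards [h.eventually (by simp)] with q hq
  exact hq.hasDerivAt_partialE.2.symm

/-- A function that is `2 * π`-periodic in the first variable and continuous on a box is uniformly
continuous there in the other variables. -/
theorem uniform_modulus_of_periodic {R : ℝ × ℝ × ℝ → ℝ} {a b ε₁ : ℝ}
    (hper : ∀ θ E ε, R (θ + 2 * Real.pi, E, ε) = R (θ, E, ε))
    (hR : ∀ θ, ∀ E ∈ Icc a b, ∀ ε, |ε| ≤ ε₁ → ContinuousAt R (θ, E, ε)) {κ : ℝ} (hκ : 0 < κ) :
    ∃ r > 0, ∀ θ, ∀ E ∈ Icc a b, ∀ E' ∈ Icc a b, ∀ ε, |ε| ≤ ε₁ → |E - E'| < r → |ε| < r →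
      |R (θ, E, ε) - R (θ, E', 0)| < κ := by
  have hK : IsCompact (Icc 0 (2 * Real.pi) ×ˢ (Icc a b ×ˢ Icc (-ε₁) ε₁)) :=
    isCompact_Icc.prod (isCompact_Icc.prod isCompact_Icc)
  have hc : ContinuousOn R (Icc 0 (2 * Real.pi) ×ˢ (Icc a b ×ˢ Icc (-ε₁) ε₁)) := by
    rintro ⟨θ, E, ε⟩ ⟨_, hE, hε⟩
    exact (hR θ E hE ε (abs_le.2 hε)).continuousWithinAt
  obtain ⟨r, hr, h⟩ := Metric.uniformContinuousOn_iff.1 (hK.uniformContinuousOn_of_continuous hc)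
    κ hκ
  refine ⟨r, hr, fun θ E hE E' hE' ε hε h1 h2 => ?_⟩
  have hper' : ∀ E ε, Function.Periodic (fun θ => R (θ, E, ε)) (2 * Real.pi) :=
    fun E ε θ => hper θ E ε
  obtain ⟨n, hn, -⟩ := existsUnique_zsmul_near_of_pos' Real.two_pi_pos θ
  have e1 := (hper' E ε).sub_zsmul_eq n (x := θ)
  have e2 := (hper' E' 0).sub_zsmul_eq n (x := θ)
  rw [← e1, ← e2]
  have hθ : θ - n • (2 * Real.pi) ∈ Icc 0 (2 * Real.pi) := ⟨hn.1, hn.2.le⟩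
  have := h (θ - n • (2 * Real.pi), E, ε) ⟨hθ, hE, abs_le.1 hε⟩ (θ - n • (2 * Real.pi), E', 0)
    ⟨hθ, hE', abs_le.1 (by simpa using (abs_nonneg ε).trans hε)⟩
    (by simp [Prod.dist_eq, Real.dist_eq, h1, h2])
  simpa [Real.dist_eq] using this

theorem exists_bound_of_periodic {R : ℝ × ℝ × ℝ → ℝ} {a b ε₁ : ℝ}
    (hR : ∀ θ, ∀ E ∈ Icc a b, ∀ ε, |ε| ≤ ε₁ → ContinuousAt R (θ, E, ε)) :
    ∃ C > 0, ∀ θ ∈ Icc 0 (2 * Real.pi), ∀ E ∈ Icc a b, ∀ ε, |ε| ≤ ε₁ → |R (θ, E, ε)| ≤ C := by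
  have hK : IsCompact (Icc 0 (2 * Real.pi) ×ˢ (Icc a b ×ˢ Icc (-ε₁) ε₁)) :=
    isCompact_Icc.prod (isCompact_Icc.prod isCompact_Icc)
  have hc : ContinuousOn R (Icc 0 (2 * Real.pi) ×ˢ (Icc a b ×ˢ Icc (-ε₁) ε₁)) := by
    rintro ⟨θ, E, ε⟩ ⟨_, hE, hε⟩
    exact (hR θ E hE ε (abs_le.2 hε)).continuousWithinAt
  obtain ⟨C, hC⟩ := hK.exists_bound_of_continuousOn hc
  refine ⟨max C 1, by positivity, fun θ hθ E hE ε hε => ?_⟩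
  exact (hC (θ, E, ε) ⟨hθ, hE, abs_le.1 hε⟩).trans (le_max_left _ _)

/-- Two solutions of a scalar periodic equation in a thin strip, with a common period, coincide
if the average of the linearization along the centre of the strip does not vanish. -/
theorem periodic_solutions_eq {R : ℝ × ℝ × ℝ → ℝ} {a b h₀ ε η : ℝ}
    (hper : ∀ θ E ε, R (θ + 2 * Real.pi, E, ε) = R (θ, E, ε))
    (hε : 0 < ε)
    (hR₀ : ∀ θ, ContDiffAt ℝ 1 R (θ, h₀, 0))
    (hR : ∀ θ, ∀ E ∈ Icc a b, ContDiffAt ℝ 1 R (θ, E, ε))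
    (hη : ∀ θ, ∀ E ∈ Icc a b, |partialE R (θ, E, ε) - partialE R (θ, h₀, 0)| ≤ η)
    (hm : 2 * Real.pi * η < |∫ θ in (0 : ℝ)..2 * Real.pi, partialE R (θ, h₀, 0)|)
    {e₁ e₂ : ℝ → ℝ} (he₁ : ∀ θ, e₁ θ ∈ Icc a b) (he₂ : ∀ θ, e₂ θ ∈ Icc a b)
    (hd₁ : ∀ θ, HasDerivAt e₁ (ε * R (θ, e₁ θ, ε)) θ)
    (hd₂ : ∀ θ, HasDerivAt e₂ (ε * R (θ, e₂ θ, ε)) θ)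
    {k : ℕ} (hk : 0 < k) (hp₁ : Function.Periodic e₁ (k * (2 * Real.pi)))
    (hp₂ : Function.Periodic e₂ (k * (2 * Real.pi))) : e₁ = e₂ := by
  set q : ℝ → ℝ := fun θ => partialE R (θ, h₀, 0) with hq
  have hqc : Continuous q := by
    refine continuous_iff_continuousAt.2 fun θ => ?_
    exact ContinuousAt.comp (g := partialE R) (f := fun θ : ℝ => ((θ, h₀, 0) : ℝ × ℝ × ℝ))
      (hR₀ θ).continuousAt_partialE (by fun_prop)
  have hqp : Function.Periodic q (2 * Real.pi) := by
    intro θ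
    simp only [hq, partialE, hper]
  set m := ∫ θ in (0 : ℝ)..2 * Real.pi, q θ with hmdef
  -- the quotient of differences is close to `q`
  have key : ∀ θ, ∀ x ∈ Icc a b, ∀ y ∈ Icc a b,
      |(R (θ, x, ε) - R (θ, y, ε)) - q θ * (x - y)| ≤ η * |x - y| := by
    intro θ x hx y hy
    have hder : ∀ E ∈ Icc a b, HasDerivWithinAt (fun E => R (θ, E, ε) - q θ * E)
        (partialE R (θ, E, ε) - q θ) (Icc a b) E := by
      intro E hE
      have h1 := ((hR θ E hE).hasDerivAt_partialE.1).sub ((hasDerivAt_id E).const_mul (q θ))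
      exact (h1.congr_deriv (by simp)).hasDerivWithinAt
    have := Convex.norm_image_sub_le_of_norm_hasDerivWithin_le hder
      (fun E hE => by simpa [Real.norm_eq_abs] using hη θ E hE) (convex_Icc a b) hy hx
    simp only [Real.norm_eq_abs] at this
    convert this using 2
    ring
  have hint : ∀ θ₀ (c : ℝ), ∫ θ in θ₀..(θ₀ + k * (2 * Real.pi)), (q θ + c)
      = k * (m + 2 * Real.pi * c) := by
    intro θ₀ c
    rw [intervalIntegral.integral_add (hqc.intervalIntegrable _ _) (by simp)]
    have := hqp.intervalIntegral_add_zsmul_eq k θ₀ (fun a b => hqc.intervalIntegrable a b)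
    simp only [natCast_zsmul, nsmul_eq_mul] at this
    rw [this, hqp.intervalIntegral_add_eq θ₀ 0]
    simp [hmdef]
    ring
  funext θ₀
  by_contra hne
  have hpos : 0 < (e₁ θ₀ - e₂ θ₀) ^ 2 := by
    have : e₁ θ₀ - e₂ θ₀ ≠ 0 := sub_ne_zero.2 hne
    positivity
  have hend : (e₁ (θ₀ + k * (2 * Real.pi)) - e₂ (θ₀ + k * (2 * Real.pi))) ^ 2
      = (e₁ θ₀ - e₂ θ₀) ^ 2 := by rw [hp₁ θ₀, hp₂ θ₀]
  have hder : ∀ c θ, HasDerivAt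
      (fun θ => (e₁ θ - e₂ θ) ^ 2 * Real.exp (-(2 * ε) * ∫ s in θ₀..θ, (q s + c)))
      (2 * ε * ((e₁ θ - e₂ θ) * ((R (θ, e₁ θ, ε) - R (θ, e₂ θ, ε)) - q θ * (e₁ θ - e₂ θ))
        - c * (e₁ θ - e₂ θ) ^ 2) * Real.exp (-(2 * ε) * ∫ s in θ₀..θ, (q s + c))) θ := by
    intro c θ
    have h1 := (((hd₁ θ).sub (hd₂ θ)).pow 2)
    have h2 : HasDerivAt (fun θ => ∫ s in θ₀..θ, (q s + c)) (q θ + c) θ :=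
      intervalIntegral.integral_hasDerivAt_right ((hqc.add continuous_const).intervalIntegrable _ _)
        ((hqc.add continuous_const).stronglyMeasurableAtFilter _ _)
        (hqc.add continuous_const).continuousAt
    have h3 := h1.mul ((h2.const_mul (-(2 * ε))).exp)
    refine h3.congr_deriv ?_
    simp
    ring
  have hk' : (0 : ℝ) < k := by exact_mod_cast hk
  have hkp : 0 < k * (2 * Real.pi) := by positivity
  have hbd : ∀ θ, |(e₁ θ - e₂ θ) * ((R (θ, e₁ θ, ε) - R (θ, e₂ θ, ε)) - q θ * (e₁ θ - e₂ θ))|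
      ≤ η * (e₁ θ - e₂ θ) ^ 2 := by
    intro θ
    rw [abs_mul, ← sq_abs (e₁ θ - e₂ θ)]
    have := key θ _ (he₁ θ) _ (he₂ θ)
    nlinarith [abs_nonneg (e₁ θ - e₂ θ)]
  rcases lt_abs.1 hm with h | h
  · have hmono : Monotone
        (fun θ => (e₁ θ - e₂ θ) ^ 2 * Real.exp (-(2 * ε) * ∫ s in θ₀..θ, (q s + (-η)))) := by
      refine monotone_of_hasDerivAt_nonneg (hder (-η)) fun θ => ?_
      have := (abs_le.1 (hbd θ)).1
      have h0 : 0 ≤ (e₁ θ - e₂ θ) * ((R (θ, e₁ θ, ε) - R (θ, e₂ θ, ε)) - q θ * (e₁ θ - e₂ θ))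
        - -η * (e₁ θ - e₂ θ) ^ 2 := by linarith
      simp only [Pi.zero_apply]
      positivity
    have := hmono (show θ₀ ≤ θ₀ + k * (2 * Real.pi) by linarith)
    simp only [hint, intervalIntegral.integral_same, mul_zero, Real.exp_zero, mul_one, hend]
      at this
    have hlt : Real.exp (-(2 * ε) * (k * (m + 2 * Real.pi * -η))) < 1 := by
      rw [Real.exp_lt_one_iff]
      have : 0 < k * (m + 2 * Real.pi * -η) := mul_pos hk' (by linarith)
      nlinarith
    nlinarith
  · have hanti : Antitone
        (fun θ => (e₁ θ - e₂ θ) ^ 2 * Real.exp (-(2 * ε) * ∫ s in θ₀..θ, (q s + η))) := by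
      refine antitone_of_hasDerivAt_nonpos (hder η) fun θ => ?_
      have := (abs_le.1 (hbd θ)).2
      have h0 : (e₁ θ - e₂ θ) * ((R (θ, e₁ θ, ε) - R (θ, e₂ θ, ε)) - q θ * (e₁ θ - e₂ θ))
        - η * (e₁ θ - e₂ θ) ^ 2 ≤ 0 := by linarith
      simp only [Pi.zero_apply]
      refine mul_nonpos_of_nonpos_of_nonneg ?_ (Real.exp_pos _).le
      exact mul_nonpos_of_nonneg_of_nonpos (by positivity) h0
    have := hanti (show θ₀ ≤ θ₀ + k * (2 * Real.pi) by linarith)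
    simp only [hint, intervalIntegral.integral_same, mul_zero, Real.exp_zero, mul_one, hend]
      at this
    have hlt : 1 < Real.exp (-(2 * ε) * (k * (m + 2 * Real.pi * η))) := by
      rw [Real.one_lt_exp_iff]
      have : k * (m + 2 * Real.pi * η) < 0 := mul_neg_of_pos_of_neg hk' (by linarith)
      nlinarith
    nlinarith

/-- A solution on one period with equal end values extends to a periodic solution. -/
theorem exists_periodic_extension {F : ℝ → ℝ → ℝ} {T : ℝ} (hT : 0 < T)
    (hF : Continuous fun p : ℝ × ℝ => F p.1 p.2)
    (hper : ∀ θ E, F (θ + T) E = F θ E) {α : ℝ → ℝ}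
    (hα : ∀ t ∈ Icc 0 T, HasDerivWithinAt α (F t (α t)) (Icc 0 T) t) (hend : α T = α 0) :
    ∃ e : ℝ → ℝ, Function.Periodic e T ∧ (∀ θ, HasDerivAt e (F θ (e θ)) θ) ∧
      ∀ θ, ∃ t ∈ Icc 0 T, e θ = α t := by
  have hαc : ContinuousOn α (Icc 0 T) := fun t ht => (hα t ht).continuousWithinAt
  have : Fact (0 < T) := ⟨hT⟩
  set u : ℝ → ℝ := fun θ => AddCircle.liftIco T 0 α (θ : AddCircle T) with hu
  have huc : Continuous u :=
    (AddCircle.liftIco_zero_continuous hend.symm hαc).comp (AddCircle.continuous_mk' T)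
  have hup : Function.Periodic u T := fun θ => by simp [hu]
  have huα : ∀ t ∈ Icc 0 T, u t = α t := by
    intro t ht
    rcases ht.2.lt_or_eq with h | rfl
    · exact AddCircle.liftIco_zero_coe_apply ⟨ht.1, h⟩
    · have h0 := hup 0
      rw [zero_add] at h0
      rw [h0, hend]
      exact AddCircle.liftIco_zero_coe_apply ⟨le_rfl, hT⟩
  set G : ℝ → ℝ := fun θ => F θ (u θ) with hG
  have hGc : Continuous G := hF.comp (continuous_id.prodMk huc)
  have hGp : Function.Periodic G T := fun θ => by simp only [hG]; rw [hper, hup]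
  set e : ℝ → ℝ := fun θ => α 0 + ∫ s in (0 : ℝ)..θ, G s with he
  have heα : ∀ t ∈ Icc 0 T, e t = α t := by
    intro t ht
    have : ∫ s in (0 : ℝ)..t, G s = α t - α 0 := by
      refine intervalIntegral.integral_eq_sub_of_hasDerivAt_of_le ht.1
        (hαc.mono (Icc_subset_Icc_right ht.2)) (fun x hx => ?_) (hGc.intervalIntegrable _ _)
      have hx' : x ∈ Icc 0 T := ⟨hx.1.le, hx.2.le.trans ht.2⟩
      simp only [hG, huα x hx']
      exact (hα x hx').hasDerivAt (Icc_mem_nhds hx.1 (hx.2.trans_le ht.2))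
    simp [he, this]
  have hint0 : ∫ s in (0 : ℝ)..T, G s = 0 := by
    have := heα T ⟨hT.le, le_rfl⟩
    simp only [he, hend] at this
    linarith
  have hep : Function.Periodic e T := by
    intro θ
    have h1 := hGp.intervalIntegral_add_eq θ 0
    have h2 := intervalIntegral.integral_add_adjacent_intervals
      (hGc.intervalIntegrable (μ := volume) 0 θ) (hGc.intervalIntegrable θ (θ + T))
    simp only [he, ← h2, h1, zero_add, hint0, add_zero]
  have heq : ∀ θ, ∃ t ∈ Icc 0 T, θ - t ∈ AddSubgroup.zmultiples T ∧ e θ = e t ∧ u θ = u t := by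
    intro θ
    obtain ⟨n, hn, -⟩ := existsUnique_zsmul_near_of_pos' hT θ
    refine ⟨θ - n • T, ⟨hn.1, hn.2.le⟩, ⟨n, by simp⟩, (hep.sub_zsmul_eq n).symm,
      (hup.sub_zsmul_eq n).symm⟩
  have heu : ∀ θ, e θ = u θ := by
    intro θ
    obtain ⟨t, ht, -, h1, h2⟩ := heq θ
    rw [h1, h2, heα t ht, huα t ht]
  refine ⟨e, hep, fun θ => ?_, fun θ => ?_⟩
  · rw [heu θ]
    exact (intervalIntegral.integral_hasDerivAt_right (hGc.intervalIntegrable _ _)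
      (hGc.stronglyMeasurableAtFilter _ _) hGc.continuousAt).const_add _
  · obtain ⟨t, ht, -, h1, -⟩ := heq θ
    exact ⟨t, ht, h1.trans (heα t ht)⟩

/-- If the averaged equation changes sign between `a` and `b`, then for small `ε` the equation
`E' = ε R (θ, E, ε)` has a periodic solution close to `[a, b]`. -/
theorem exists_periodic_solution_of_sign_change {R : ℝ × ℝ × ℝ → ℝ} {a₀ a b b₀ ε₁ : ℝ}
    (ha : a₀ < a) (hab : a ≤ b) (hb : b < b₀) (hε₁ : 0 < ε₁)
    (hper : ∀ θ E ε, R (θ + 2 * Real.pi, E, ε) = R (θ, E, ε))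
    (hR : ∀ θ, ∀ E ∈ Icc a₀ b₀, ∀ ε, |ε| ≤ ε₁ → ContDiffAt ℝ 1 R (θ, E, ε))
    (hM : (∫ θ in (0 : ℝ)..2 * Real.pi, R (θ, a, 0)) * (∫ θ in (0 : ℝ)..2 * Real.pi, R (θ, b, 0))
      < 0) :
    ∃ ε₀ > 0, ∀ ε, 0 < ε → ε ≤ ε₀ → ∃ e : ℝ → ℝ, Function.Periodic e (2 * Real.pi) ∧
      (∀ θ, e θ ∈ Icc a₀ b₀) ∧ ∀ θ, HasDerivAt e (ε * R (θ, e θ, ε)) θ := by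
  have hpi := Real.two_pi_pos
  have hab₀ : a₀ ≤ b₀ := by linarith
  have hcont : ∀ θ, ∀ E ∈ Icc a₀ b₀, ∀ ε, |ε| ≤ ε₁ → ContinuousAt R (θ, E, ε) :=
    fun θ E hE ε hε => (hR θ E hE ε hε).continuousAt
  set M : ℝ → ℝ := fun E => ∫ θ in (0 : ℝ)..2 * Real.pi, R (θ, E, 0) with hMdef
  have hMa : M a ≠ 0 := fun h => by simp only [hMdef] at h; simp [h] at hM
  have hMb : M b ≠ 0 := fun h => by simp only [hMdef] at h; simp [h] at hM
  set κ := min |M a| |M b| / (4 * Real.pi) with hκdef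
  have hκ : 0 < κ := by positivity
  have h2κ : 2 * Real.pi * κ < min |M a| |M b| := by
    have : 0 < min |M a| |M b| := by positivity
    have h3 : 2 * Real.pi * κ = min |M a| |M b| / 2 := by
      rw [hκdef]; field_simp; ring
    linarith
  obtain ⟨r, hr, hmod⟩ := uniform_modulus_of_periodic hper hcont hκ
  obtain ⟨C, hC, hbound⟩ := exists_bound_of_periodic hcont
  obtain ⟨K, hK, hlip⟩ := exists_bound_of_periodic (R := partialE R)
    (fun θ E hE ε hε => (hR θ E hE ε hε).continuousAt_partialE)
  set s := min r (min (a - a₀) (b₀ - b)) with hs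
  have hspos : 0 < s := lt_min hr (lt_min (by linarith) (by linarith))
  refine ⟨min (ε₁) (min (r / 2) (s / (2 * (C * (2 * Real.pi))))), by positivity,
    fun ε hε hε₀ => ?_⟩
  have hεε₁ : |ε| ≤ ε₁ := by rw [abs_of_pos hε]; exact hε₀.trans (min_le_left _ _)
  have hεr : |ε| < r := by
    rw [abs_of_pos hε]
    have := hε₀.trans ((min_le_right _ _).trans (min_le_left _ _))
    linarith
  have hεs : ε * C * (2 * Real.pi) < s := by
    have := hε₀.trans ((min_le_right _ _).trans (min_le_right _ _))
    rw [le_div_iff₀ (by positivity)] at this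
    nlinarith
  set cl : ℝ → ℝ := fun E => max a₀ (min E b₀) with hcl
  have hclm : ∀ E, cl E ∈ Icc a₀ b₀ := fun E => ⟨le_max_left _ _, max_le hab₀ (min_le_right _ _)⟩
  have hcle : ∀ E ∈ Icc a₀ b₀, cl E = E := fun E hE => by
    simp [hcl, hE.1, hE.2]
  have hcll : ∀ x y, |cl x - cl y| ≤ |x - y| := by
    intro x y
    simp only [hcl]
    refine (abs_max_sub_max_le_max _ _ _ _).trans ?_
    refine max_le (by simp) ?_
    exact (abs_min_sub_min_le_max _ _ _ _).trans (max_le le_rfl (by simp))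
  set F : ℝ → ℝ → ℝ := fun θ E => ε * R (θ, cl E, ε) with hF
  have hFc : Continuous fun p : ℝ × ℝ => F p.1 p.2 := by
    refine continuous_const.mul (continuous_iff_continuousAt.2 fun p => ?_)
    refine ContinuousAt.comp (g := R) (f := fun p : ℝ × ℝ => ((p.1, cl p.2, ε) : ℝ × ℝ × ℝ))
      (hcont p.1 _ (hclm _) ε hεε₁) ?_
    exact Continuous.continuousAt (by fun_prop)
  have hFb : ∀ θ ∈ Icc 0 (2 * Real.pi), ∀ E, ‖F θ E‖ ≤ ε * C := by
    intro θ hθ E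
    rw [Real.norm_eq_abs, abs_mul, abs_of_pos hε]
    exact mul_le_mul_of_nonneg_left (hbound θ hθ _ (hclm E) ε hεε₁) hε.le
  have hFl : ∀ θ ∈ Icc 0 (2 * Real.pi), ∀ x y, ‖F θ x - F θ y‖ ≤ ε * K * ‖x - y‖ := by
    intro θ hθ x y
    have := Convex.norm_image_sub_le_of_norm_hasDerivWithin_le (f := fun E => R (θ, E, ε))
      (fun E hE => ((hR θ E hE ε hεε₁).hasDerivAt_partialE.1).hasDerivWithinAt)
      (fun E hE => hlip θ hθ E hE ε hεε₁) (convex_Icc a₀ b₀) (hclm y) (hclm x)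
    simp only [Real.norm_eq_abs] at this ⊢
    simp only [hF, ← mul_sub, abs_mul, abs_of_pos hε]
    rw [mul_assoc]
    refine mul_le_mul_of_nonneg_left (this.trans ?_) hε.le
    exact mul_le_mul_of_nonneg_left (hcll x y) hK.le
  have h0mem : (0 : ℝ) ∈ Icc 0 (2 * Real.pi) := ⟨le_rfl, hpi.le⟩
  have hPL : IsPicardLindelof F (tmin := 0) (tmax := 2 * Real.pi) ⟨0, h0mem⟩ ((a + b) / 2)
      (Real.toNNReal ((b - a) / 2 + ε * C * (2 * Real.pi))) (Real.toNNReal ((b - a) / 2))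
      (Real.toNNReal (ε * C)) (Real.toNNReal (ε * K)) := by
    refine ⟨fun t ht => LipschitzOnWith.of_dist_le_mul fun x _ y _ => ?_, fun x _ => ?_,
      fun t ht x _ => ?_, ?_⟩
    · rw [dist_eq_norm, dist_eq_norm, Real.coe_toNNReal _ (by positivity)]
      exact hFl t ht x y
    · exact (hFc.comp (continuous_id.prodMk continuous_const)).continuousOn
    · rw [Real.coe_toNNReal _ (by positivity)]
      exact hFb t ht x
    · have h1 : 0 ≤ (b - a) / 2 := by linarith
      rw [Real.coe_toNNReal _ (by positivity), Real.coe_toNNReal _ (by positivity),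
        Real.coe_toNNReal _ h1]
      simp only [sub_zero, sub_self]
      rw [max_eq_left hpi.le]
      linarith
  obtain ⟨α, hα, L', hL'⟩ := hPL.exists_forall_mem_closedBall_eq_hasDerivWithinAt_lipschitzOnWith
  have hball : Metric.closedBall ((a + b) / 2) (Real.toNNReal ((b - a) / 2) : ℝ) = Icc a b := by
    rw [Real.coe_toNNReal _ (by linarith), Real.closedBall_eq_Icc]
    congr 1 <;> ring
  rw [hball] at hα hL'
  have hdist : ∀ x ∈ Icc a b, ∀ t ∈ Icc 0 (2 * Real.pi), |α x t - x| < s := by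
    intro x hx t ht
    have h1 := norm_image_sub_le_of_norm_deriv_le_segment' (hα x hx).2
      (C := ε * C) (fun t ht => hFb t ⟨ht.1, ht.2.le⟩ _) t ht
    rw [(hα x hx).1, Real.norm_eq_abs] at h1
    have : ε * C * (t - 0) ≤ ε * C * (2 * Real.pi) := by
      refine mul_le_mul_of_nonneg_left ?_ (by positivity)
      linarith [ht.2]
    linarith
  have hstay : ∀ x ∈ Icc a b, ∀ t ∈ Icc 0 (2 * Real.pi), α x t ∈ Icc a₀ b₀ := by
    intro x hx t ht
    have h1 := abs_lt.1 (hdist x hx t ht)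
    have h2 : s ≤ a - a₀ := (min_le_right _ _).trans (min_le_left _ _)
    have h3 : s ≤ b₀ - b := (min_le_right _ _).trans (min_le_right _ _)
    exact ⟨by linarith [hx.1], by linarith [hx.2]⟩
  have hdisp : ∀ x ∈ Icc a b, |α x (2 * Real.pi) - x - ε * M x| ≤ ε * (2 * Real.pi * κ) := by
    intro x hx
    have hxm : x ∈ Icc a₀ b₀ := ⟨by linarith [hx.1], by linarith [hx.2]⟩
    have hαc : ContinuousOn (α x) (Icc 0 (2 * Real.pi)) :=
      fun t ht => ((hα x hx).2 t ht).continuousWithinAt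
    have hi1 : IntervalIntegrable (fun t => F t (α x t)) volume 0 (2 * Real.pi) := by
      refine ContinuousOn.intervalIntegrable ?_
      rw [uIcc_of_le hpi.le]
      exact hFc.comp_continuousOn (continuousOn_id.prodMk hαc)
    have hi2 : IntervalIntegrable (fun t => R (t, x, 0)) volume 0 (2 * Real.pi) := by
      refine Continuous.intervalIntegrable (continuous_iff_continuousAt.2 fun t => ?_) _ _
      exact ContinuousAt.comp (g := R) (f := fun t : ℝ => ((t, x, 0) : ℝ × ℝ × ℝ))
        (hcont t x hxm 0 (by simpa using hε₁.le)) (by fun_prop)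
    have h1 : ∫ t in (0 : ℝ)..2 * Real.pi, F t (α x t) = α x (2 * Real.pi) - x := by
      rw [intervalIntegral.integral_eq_sub_of_hasDerivAt_of_le hpi.le hαc
        (fun t ht => ((hα x hx).2 t ⟨ht.1.le, ht.2.le⟩).hasDerivAt (Icc_mem_nhds ht.1 ht.2)) hi1]
      congr 1
      exact (hα x hx).1
    rw [← h1, hMdef, ← intervalIntegral.integral_const_mul,
      ← intervalIntegral.integral_sub hi1 (hi2.const_mul ε)]
    have := intervalIntegral.norm_integral_le_of_norm_le_const (a := 0) (b := 2 * Real.pi)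
      (C := ε * κ) (f := fun t => F t (α x t) - ε * R (t, x, 0)) ?_
    · rw [Real.norm_eq_abs, sub_zero, abs_of_pos hpi] at this
      linarith
    · intro t ht
      rw [uIoc_of_le hpi.le] at ht
      have ht' : t ∈ Icc 0 (2 * Real.pi) := ⟨ht.1.le, ht.2⟩
      simp only [hF, hcle _ (hstay x hx t ht'), ← mul_sub]
      rw [Real.norm_eq_abs, abs_mul, abs_of_pos hε]
      refine mul_le_mul_of_nonneg_left ?_ hε.le
      exact (hmod t _ (hstay x hx t ht') x hxm ε hεε₁
        ((hdist x hx t ht').trans_le (min_le_left _ _)) hεr).le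
  have hfix : ∃ x ∈ Icc a b, α x (2 * Real.pi) - x = 0 := by
    have hcon : ContinuousOn (fun x => α x (2 * Real.pi) - x) (Icc a b) :=
      (hL' (2 * Real.pi) ⟨hpi.le, le_rfl⟩).continuousOn.sub continuousOn_id
    have hda := abs_le.1 (hdisp a ⟨le_rfl, hab⟩)
    have hdb := abs_le.1 (hdisp b ⟨hab, le_rfl⟩)
    have h3 : 2 * Real.pi * κ < |M a| := h2κ.trans_le (min_le_left _ _)
    have h4 : 2 * Real.pi * κ < |M b| := h2κ.trans_le (min_le_right _ _)
    rcases mul_neg_iff.1 hM with ⟨h1, h2⟩ | ⟨h1, h2⟩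
    · change 0 < M a at h1
      change M b < 0 at h2
      rw [abs_of_pos h1] at h3
      rw [abs_of_neg h2] at h4
      exact intermediate_value_Icc' hab hcon ⟨by nlinarith, by nlinarith⟩
    · change M a < 0 at h1
      change 0 < M b at h2
      rw [abs_of_neg h1] at h3
      rw [abs_of_pos h2] at h4
      exact intermediate_value_Icc hab hcon ⟨by nlinarith, by nlinarith⟩
  obtain ⟨x, hx, hx0⟩ := hfix
  have hαx0 : α x 0 = x := (hα x hx).1
  obtain ⟨e, hep, hed, heα⟩ := exists_periodic_extension hpi hFc
    (fun θ E => by simp only [hF, hper]) (hα x hx).2 (by linarith)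
  have hem : ∀ θ, e θ ∈ Icc a₀ b₀ := by
    intro θ
    obtain ⟨t, ht, h⟩ := heα θ
    rw [h]
    exact hstay x hx t ht
  refine ⟨e, hep, hem, fun θ => ?_⟩
  have := hed θ
  simpa only [hF, hcle _ (hem θ)] using this

/-- First order averaging: near a simple zero of the averaged function, the equation
`E' = ε R (θ, E, ε)` has exactly one periodic solution for small `ε > 0`. -/
theorem exists_unique_periodic_solution {R : ℝ × ℝ × ℝ → ℝ} {h₀ δ ε₁ m : ℝ}
    (hδ : 0 < δ) (hε₁ : 0 < ε₁)
    (hper : ∀ θ E ε, R (θ + 2 * Real.pi, E, ε) = R (θ, E, ε))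
    (hR : ∀ θ, ∀ E ∈ Icc (h₀ - δ) (h₀ + δ), ∀ ε, |ε| ≤ ε₁ → ContDiffAt ℝ 1 R (θ, E, ε))
    (h0 : ∫ θ in (0 : ℝ)..2 * Real.pi, R (θ, h₀, 0) = 0)
    (hM : HasDerivAt (fun E => ∫ θ in (0 : ℝ)..2 * Real.pi, R (θ, E, 0)) m h₀)
    (hm : m = ∫ θ in (0 : ℝ)..2 * Real.pi, partialE R (θ, h₀, 0)) (hm0 : m ≠ 0) :
    ∃ δ₀ > 0, δ₀ ≤ δ ∧ ∃ ε₀ > 0, ε₀ ≤ ε₁ ∧ ∀ ε, 0 < ε → ε ≤ ε₀ → ∃ e : ℝ → ℝ,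
      Function.Periodic e (2 * Real.pi) ∧ (∀ θ, e θ ∈ Ioo (h₀ - δ₀) (h₀ + δ₀)) ∧
      (∀ θ, HasDerivAt e (ε * R (θ, e θ, ε)) θ) ∧
      ∀ e' : ℝ → ℝ, (∀ θ, e' θ ∈ Ioo (h₀ - δ₀) (h₀ + δ₀)) →
        (∀ θ, HasDerivAt e' (ε * R (θ, e' θ, ε)) θ) →
        ∀ k : ℕ, 0 < k → Function.Periodic e' (k * (2 * Real.pi)) → e' = e := by
  have hpi := Real.two_pi_pos
  have hperd : ∀ θ E ε, partialE R (θ + 2 * Real.pi, E, ε) = partialE R (θ, E, ε) := by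
    intro θ E ε
    simp only [partialE, hper]
  have hη : 0 < |m| / (4 * Real.pi) := by positivity
  obtain ⟨r, hr, hmod⟩ := uniform_modulus_of_periodic hperd
    (fun θ E hE ε hε => (hR θ E hE ε hε).continuousAt_partialE) hη
  set δ₀ := min δ (r / 2) with hδ₀
  have hδ₀pos : 0 < δ₀ := by positivity
  have hδ₀δ : δ₀ ≤ δ := min_le_left _ _
  have hδ₀r : δ₀ < r := (min_le_right _ _).trans_lt (by linarith)
  -- sign change of the averaged function at distance less than `δ₀ / 2`
  set M : ℝ → ℝ := fun E => ∫ θ in (0 : ℝ)..2 * Real.pi, R (θ, E, 0) with hMdef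
  have hM0 : M h₀ = 0 := h0
  have hslope := hasDerivAt_iff_tendsto_slope_zero.1 hM
  have hev : ∀ᶠ t in 𝓝[≠] (0 : ℝ), 0 < m * (t⁻¹ * (M (h₀ + t) - M h₀)) := by
    have h1 : Tendsto (fun t => m * (t⁻¹ • (M (h₀ + t) - M h₀))) (𝓝[≠] 0) (𝓝 (m * m)) :=
      hslope.const_mul m
    exact h1.eventually (lt_mem_nhds (mul_self_pos.2 hm0))
  rw [eventually_nhdsWithin_iff, Metric.eventually_nhds_iff] at hev
  obtain ⟨τ, hτ, hev⟩ := hev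
  set d := min (δ₀ / 2) (τ / 2) with hd
  have hdpos : 0 < d := by positivity
  have hdδ : d ≤ δ₀ / 2 := min_le_left _ _
  have hdτ : d < τ := (min_le_right _ _).trans_lt (by linarith)
  have hplus := hev (y := d) (by simp [abs_of_pos hdpos, hdτ]) (by simpa using hdpos.ne')
  have hminus := hev (y := -d) (by simp [abs_of_pos hdpos, hdτ]) (by simpa using hdpos.ne')
  have hsign : M (h₀ - d) * M (h₀ + d) < 0 := by
    rw [hM0, sub_zero] at hplus hminus
    rw [← sub_eq_add_neg, inv_neg] at hminus
    have h1 : 0 < m * M (h₀ + d) := by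
      have : m * M (h₀ + d) = d * (m * (d⁻¹ * M (h₀ + d))) := by field_simp
      rw [this]; positivity
    have h2 : m * M (h₀ - d) < 0 := by
      have : m * M (h₀ - d) = - (d * (m * (-d⁻¹ * M (h₀ - d)))) := by field_simp
      rw [this]; exact neg_neg_of_pos (by positivity)
    have h3 : (m * m) * (M (h₀ - d) * M (h₀ + d)) < 0 := by nlinarith
    exact neg_of_mul_neg_right h3 (mul_self_nonneg m)
  obtain ⟨ε₀, hε₀, hex⟩ := exists_periodic_solution_of_sign_change (a₀ := h₀ - 3 * δ₀ / 4)
    (b₀ := h₀ + 3 * δ₀ / 4) (by linarith) (by linarith) (by linarith) hε₁ hper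
    (fun θ E hE ε hε => hR θ E ⟨by linarith [hE.1], by linarith [hE.2]⟩ ε hε) hsign
  refine ⟨δ₀, hδ₀pos, hδ₀δ, min ε₀ (min ε₁ (r / 2)), by positivity,
    (min_le_right _ _).trans (min_le_left _ _), fun ε hε hle => ?_⟩
  have hεε₁ : |ε| ≤ ε₁ := by
    rw [abs_of_pos hε]; exact hle.trans ((min_le_right _ _).trans (min_le_left _ _))
  have hεr : |ε| < r := by
    rw [abs_of_pos hε]
    have := hle.trans ((min_le_right _ _).trans (min_le_right _ _))
    linarith
  obtain ⟨e, hep, hem, hed⟩ := hex ε hε (hle.trans (min_le_left _ _))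
  have hem' : ∀ θ, e θ ∈ Ioo (h₀ - δ₀) (h₀ + δ₀) := fun θ =>
    ⟨by linarith [(hem θ).1], by linarith [(hem θ).2]⟩
  have hsub : ∀ E ∈ Icc (h₀ - δ₀) (h₀ + δ₀), E ∈ Icc (h₀ - δ) (h₀ + δ) := fun E hE =>
    ⟨by linarith [hE.1], by linarith [hE.2]⟩
  have hh₀ : h₀ ∈ Icc (h₀ - δ) (h₀ + δ) := ⟨by linarith, by linarith⟩
  refine ⟨e, hep, hem', hed, fun e' hem2 hed2 k hk hp2 => ?_⟩
  refine periodic_solutions_eq (a := h₀ - δ₀) (b := h₀ + δ₀) (η := |m| / (4 * Real.pi)) hper hε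
    (fun θ => hR θ h₀ hh₀ 0 (by simpa using hε₁.le)) (fun θ E hE => hR θ E (hsub E hE) ε hεε₁)
    (fun θ E hE => (hmod θ E (hsub E hE) h₀ hh₀ ε hεε₁
      ((abs_le.2 ⟨by linarith [hE.1], by linarith [hE.2]⟩ : |E - h₀| ≤ δ₀).trans_lt hδ₀r) hεr).le)
    ?_ (fun θ => Ioo_subset_Icc_self (hem2 θ)) (fun θ => Ioo_subset_Icc_self (hem' θ)) hed2 hed hk
    hp2 (hep.nat_mul k)
  rw [← hm]
  have : 2 * Real.pi * (|m| / (4 * Real.pi)) = |m| / 2 := by field_simp; ring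
  rw [this]
  have := abs_pos.2 hm0
  linarith

/-- The energy `y² / 2 + Q x` in polar coordinates. -/
noncomputable def polarEnergy (Q : ℝ[X]) (θ r : ℝ) : ℝ :=
  (r * Real.sin θ) ^ 2 / 2 + Q.eval (r * Real.cos θ)

/-- The potential `Q` is coercive, and its energy levels above `lo` are star-shaped. -/
def StarAbove (Q : ℝ[X]) (lo : ℝ) : Prop :=
  Tendsto (fun x => Q.eval x) (cocompact ℝ) atTop ∧
    ∀ x, 2 * Q.eval x - x * Q.derivative.eval x < 2 * lo

/-- The polar radius of the energy level `h` in the direction `θ`. -/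
noncomputable def polarRadius (Q : ℝ[X]) (θ h : ℝ) : ℝ :=
  sInf {r : ℝ | 0 < r ∧ polarEnergy Q θ r = h}

theorem StarAbove.mono {Q : ℝ[X]} {lo lo' : ℝ} (hQ : StarAbove Q lo) (h : lo ≤ lo') :
    StarAbove Q lo' :=
  ⟨hQ.1, fun x => (hQ.2 x).trans_le (by linarith)⟩

theorem hasDerivAt_polarEnergy (Q : ℝ[X]) (θ r : ℝ) :
    HasDerivAt (polarEnergy Q θ)
      (r * Real.sin θ * Real.sin θ + Q.derivative.eval (r * Real.cos θ) * Real.cos θ) r := by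
  have h1 : HasDerivAt (fun r : ℝ => r * Real.sin θ) (Real.sin θ) r := by
    simpa using (hasDerivAt_id r).mul_const (Real.sin θ)
  have h2 : HasDerivAt (fun r : ℝ => r * Real.cos θ) (Real.cos θ) r := by
    simpa using (hasDerivAt_id r).mul_const (Real.cos θ)
  have h3 := ((h1.pow 2).div_const 2).add ((Q.hasDerivAt (r * Real.cos θ)).comp r h2)
  refine h3.congr_deriv ?_
  simp
  ring

theorem polarEnergy_strictMono_aux {Q : ℝ[X]} {h : ℝ} (hQ : StarAbove Q h) (θ : ℝ) :
    StrictMonoOn (fun r => (polarEnergy Q θ r - h) / r ^ 2) (Ioi 0) := by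
  have hder : ∀ r ∈ Ioi (0 : ℝ), HasDerivAt (fun r => (polarEnergy Q θ r - h) / r ^ 2)
      ((2 * h - (2 * Q.eval (r * Real.cos θ) -
        (r * Real.cos θ) * Q.derivative.eval (r * Real.cos θ))) / r ^ 3) r := by
    intro r hr
    have hr' : r ≠ 0 := (mem_Ioi.1 hr).ne'
    have h1 := ((hasDerivAt_polarEnergy Q θ r).sub_const h).div (hasDerivAt_pow 2 r)
      (pow_ne_zero 2 hr')
    refine h1.congr_deriv ?_
    simp only [polarEnergy]
    field_simp
    ring
  refine strictMonoOn_of_deriv_pos (convex_Ioi 0)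
    (fun r hr => (hder r hr).continuousAt.continuousWithinAt) fun r hr => ?_
  rw [interior_Ioi] at hr
  rw [(hder r hr).deriv]
  have := hQ.2 (r * Real.cos θ)
  have hr' : 0 < r := hr
  exact div_pos (by linarith) (by positivity)

theorem polarEnergy_eq_unique {Q : ℝ[X]} {h : ℝ} (hQ : StarAbove Q h) {θ r r' : ℝ} (hr : 0 < r)
    (hr' : 0 < r') (he : polarEnergy Q θ r = h) (he' : polarEnergy Q θ r' = h) : r = r' :=
  (polarEnergy_strictMono_aux hQ θ).injOn hr hr' (by simp [he, he'])

theorem exists_polarEnergy_eq {Q : ℝ[X]} {h : ℝ} (hQ : StarAbove Q h) (θ : ℝ) :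
    ∃ r, 0 < r ∧ polarEnergy Q θ r = h := by
  have h0 : polarEnergy Q θ 0 < h := by
    have := hQ.2 0
    simp [polarEnergy] at this ⊢
    linarith
  have htop : ∃ r, 0 < r ∧ h < polarEnergy Q θ r := by
    by_cases hc : Real.cos θ = 0
    · have hs : Real.sin θ ^ 2 = 1 := by
        have := Real.sin_sq_add_cos_sq θ
        simpa [hc] using this
      have : Tendsto (fun r : ℝ => r ^ 2 / 2 + Q.eval 0) atTop atTop :=
        tendsto_atTop_add_const_right _ _
          ((tendsto_pow_atTop two_ne_zero).atTop_div_const (by norm_num))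
      obtain ⟨r, hr1, hr2⟩ := ((this.eventually_gt_atTop h).and (eventually_gt_atTop 0)).exists
      refine ⟨r, hr2, ?_⟩
      simpa [polarEnergy, mul_pow, hs, hc] using hr1
    · have h1 : Tendsto (fun r : ℝ => r * Real.cos θ) atTop (cocompact ℝ) := by
        rw [cocompact_eq_atBot_atTop]
        rcases lt_or_gt_of_ne hc with hc | hc
        · exact (tendsto_id.atTop_mul_const_of_neg hc).mono_right le_sup_left
        · exact (tendsto_id.atTop_mul_const hc).mono_right le_sup_right
      obtain ⟨r, hr1, hr2⟩ :=
        (((hQ.1.comp h1).eventually_gt_atTop h).and (eventually_gt_atTop 0)).exists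
      refine ⟨r, hr2, ?_⟩
      simp only [polarEnergy, Function.comp_apply] at hr1 ⊢
      nlinarith [sq_nonneg (r * Real.sin θ)]
  obtain ⟨r, hr, hrh⟩ := htop
  have hcont : ContinuousOn (polarEnergy Q θ) (Icc 0 r) := fun x _ =>
    (hasDerivAt_polarEnergy Q θ x).continuousAt.continuousWithinAt
  obtain ⟨s, hs, hse⟩ := intermediate_value_Icc hr.le hcont ⟨h0.le, hrh.le⟩
  refine ⟨s, lt_of_le_of_ne hs.1 ?_, hse⟩
  rintro rfl
  exact h0.ne hse

theorem polarRadius_spec {Q : ℝ[X]} {h : ℝ} (hQ : StarAbove Q h) (θ : ℝ) :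
    0 < polarRadius Q θ h ∧ polarEnergy Q θ (polarRadius Q θ h) = h := by
  obtain ⟨r, hr, he⟩ := exists_polarEnergy_eq hQ θ
  have : {r : ℝ | 0 < r ∧ polarEnergy Q θ r = h} = {r} := by
    ext r'
    simp only [mem_ofPred_eq, mem_singleton_iff]
    constructor
    · rintro ⟨h1, h2⟩
      exact polarEnergy_eq_unique hQ h1 hr h2 he
    · rintro rfl
      exact ⟨hr, he⟩
  rw [polarRadius, this, csInf_singleton]
  exact ⟨hr, he⟩

theorem polarRadius_eq {Q : ℝ[X]} {h : ℝ} (hQ : StarAbove Q h) {θ r : ℝ} (hr : 0 < r)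
    (he : polarEnergy Q θ r = h) : polarRadius Q θ h = r :=
  polarEnergy_eq_unique hQ (polarRadius_spec hQ θ).1 hr (polarRadius_spec hQ θ).2 he

theorem polarRadius_periodic (Q : ℝ[X]) (θ h : ℝ) :
    polarRadius Q (θ + 2 * Real.pi) h = polarRadius Q θ h := by
  simp [polarRadius, polarEnergy]

theorem polarRadius_neg (Q : ℝ[X]) (θ h : ℝ) : polarRadius Q (-θ) h = polarRadius Q θ h := by
  simp [polarRadius, polarEnergy]

theorem polarRadius_pi_sub {Q : ℝ[X]} (hQ : ∀ x, Q.eval (-x) = Q.eval x) (θ h : ℝ) :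
    polarRadius Q (Real.pi - θ) h = polarRadius Q θ h := by
  simp [polarRadius, polarEnergy, hQ]

/-- The quantity `x Q'(x) + y²` is positive on star-shaped levels. -/
theorem StarAbove.pos {Q : ℝ[X]} {lo h x y : ℝ} (hQ : StarAbove Q lo) (hh : lo ≤ h)
    (he : y ^ 2 / 2 + Q.eval x = h) : 0 < x * Q.derivative.eval x + y ^ 2 := by
  have := hQ.2 x
  linarith

theorem contDiffAt_polarRadius {Q : ℝ[X]} {lo θ₀ h₀ : ℝ} (hQ : StarAbove Q lo) (hh : lo < h₀) :
    ContDiffAt ℝ 1 (fun p : ℝ × ℝ => polarRadius Q p.1 p.2) (θ₀, h₀) := by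
  obtain ⟨hr, he⟩ := polarRadius_spec (hQ.mono hh.le) θ₀
  set r₀ := polarRadius Q θ₀ h₀ with hr₀
  set f : (ℝ × ℝ) × ℝ → ℝ := fun p => polarEnergy Q p.1.1 p.2 - p.1.2 with hf
  have hQc : ContDiff ℝ 1 fun x => Q.eval x := by
    simpa using Q.contDiff_aeval (𝕜 := ℝ) 1
  have hfc : ContDiff ℝ 1 f := by
    simp only [hf, polarEnergy]
    fun_prop
  set u : (ℝ × ℝ) × ℝ := ((θ₀, h₀), r₀) with hu
  have hfu : f u = 0 := by simp [hf, hu, he]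
  have hder : HasDerivAt (fun r => f ((θ₀, h₀), r))
      (fderiv ℝ f u (ContinuousLinearMap.inr ℝ (ℝ × ℝ) ℝ 1)) r₀ :=
    HasFDerivAt.comp_hasDerivAt (l := f) (f := fun r : ℝ => (((θ₀, h₀), r) : (ℝ × ℝ) × ℝ)) r₀
      ((hfc.differentiable one_ne_zero).differentiableAt.hasFDerivAt)
      ((hasDerivAt_const _ _).prodMk (hasDerivAt_id _))
  have hval := hder.unique ((hasDerivAt_polarEnergy Q θ₀ r₀).sub_const h₀)
  have hne : fderiv ℝ f u (ContinuousLinearMap.inr ℝ (ℝ × ℝ) ℝ 1) ≠ 0 := by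
    rw [hval]
    have h1 : 0 < r₀ * Real.cos θ₀ * Q.derivative.eval (r₀ * Real.cos θ₀)
        + (r₀ * Real.sin θ₀) ^ 2 := hQ.pos hh.le he
    intro h2
    have h3 : r₀ * (r₀ * Real.sin θ₀ * Real.sin θ₀ +
      Q.derivative.eval (r₀ * Real.cos θ₀) * Real.cos θ₀) = 0 := by rw [h2, mul_zero]
    nlinarith
  have hinv : (fderiv ℝ f u ∘L .inr ℝ (ℝ × ℝ) ℝ).IsInvertible := by
    set c := fderiv ℝ f u (ContinuousLinearMap.inr ℝ (ℝ × ℝ) ℝ 1) with hc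
    refine ⟨ContinuousLinearEquiv.unitsEquivAut ℝ (Units.mk0 c hne), ?_⟩
    ext
    simp [hc]
  have hcd := hfc.contDiffAt (x := u)
  set φ := hcd.implicitFunction one_ne_zero hinv with hφ
  have hφc : ContDiffAt ℝ 1 φ (θ₀, h₀) := hcd.contDiffAt_implicitFunction one_ne_zero hinv
  have hφ0 : φ (θ₀, h₀) = r₀ := hcd.implicitFunction_apply_self one_ne_zero hinv
  refine hφc.congr_of_eventuallyEq ?_
  have e1 : ∀ᶠ x in 𝓝 (θ₀, h₀), f (x, φ x) = f u :=
    hcd.eventually_apply_implicitFunction one_ne_zero hinv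
  have e2 : ∀ᶠ x in 𝓝 (θ₀, h₀), 0 < φ x :=
    hφc.continuousAt.eventually (lt_mem_nhds (by rw [hφ0]; exact hr))
  have e3 : ∀ᶠ x : ℝ × ℝ in 𝓝 (θ₀, h₀), lo < x.2 :=
    continuousAt_snd.eventually (lt_mem_nhds hh)
  filter_upwards [e1, e2, e3] with x h1 h2 h3
  refine polarRadius_eq (hQ.mono h3.le) h2 ?_
  rw [hfu] at h1
  simp only [hf] at h1
  linarith

theorem hasDerivAt_integral_partialE {R : ℝ × ℝ × ℝ → ℝ} {a b h₀ : ℝ} (hh : h₀ ∈ Ioo a b)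
    (hR : ∀ θ, ∀ E ∈ Icc a b, ContDiffAt ℝ 1 R (θ, E, 0)) :
    HasDerivAt (fun E => ∫ θ in (0 : ℝ)..2 * Real.pi, R (θ, E, 0))
      (∫ θ in (0 : ℝ)..2 * Real.pi, partialE R (θ, h₀, 0)) h₀ := by
  have hmk : ∀ (E : ℝ), Continuous fun θ : ℝ => ((θ, E, 0) : ℝ × ℝ × ℝ) := fun E => by fun_prop
  have hc : ∀ E ∈ Icc a b, Continuous fun θ => R (θ, E, 0) := fun E hE =>
    continuous_iff_continuousAt.2 fun θ =>
      ContinuousAt.comp (f := fun θ : ℝ => ((θ, E, 0) : ℝ × ℝ × ℝ)) (hR θ E hE).continuousAt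
        (hmk E).continuousAt
  have hc' : Continuous fun θ => partialE R (θ, h₀, 0) :=
    continuous_iff_continuousAt.2 fun θ =>
      ContinuousAt.comp (f := fun θ : ℝ => ((θ, h₀, 0) : ℝ × ℝ × ℝ))
        (hR θ h₀ (Ioo_subset_Icc_self hh)).continuousAt_partialE (hmk h₀).continuousAt
  obtain ⟨C, -, hC⟩ := exists_bound_of_periodic (R := partialE R) (a := a) (b := b) (ε₁ := 0)
    fun θ E hE ε hε => by
      rw [abs_nonpos_iff.1 hε]
      exact (hR θ E hE).continuousAt_partialE
  have hs : Ioo a b ∈ 𝓝 h₀ := Ioo_mem_nhds hh.1 hh.2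
  refine (intervalIntegral.hasDerivAt_integral_of_dominated_loc_of_deriv_le (μ := volume)
    (F := fun E θ => R (θ, E, 0)) (F' := fun E θ => partialE R (θ, E, 0)) (bound := fun _ => C)
    hs ?_ ((hc _ (Ioo_subset_Icc_self hh)).intervalIntegrable _ _) hc'.aestronglyMeasurable ?_
    intervalIntegrable_const ?_).2
  · filter_upwards [hs] with E hE
    exact (hc E (Ioo_subset_Icc_self hE)).aestronglyMeasurable
  · refine Eventually.of_forall fun θ hθ E hE => ?_
    rw [uIoc_of_le (by positivity)] at hθ
    exact hC θ (Ioc_subset_Icc_self hθ) E (Ioo_subset_Icc_self hE) 0 (by simp)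
  · exact Eventually.of_forall fun θ _ E hE =>
      (hR θ E (Ioo_subset_Icc_self hE)).hasDerivAt_partialE.1

theorem continuousOn_integral_of_contDiffAt {R : ℝ × ℝ × ℝ → ℝ} {a b : ℝ}
    (hR : ∀ θ, ∀ E ∈ Icc a b, ContDiffAt ℝ 1 R (θ, E, 0)) :
    ContinuousOn (fun E => ∫ θ in (0 : ℝ)..2 * Real.pi, R (θ, E, 0)) (Icc a b) := by
  have hmk : ∀ (E : ℝ), Continuous fun θ : ℝ => ((θ, E, 0) : ℝ × ℝ × ℝ) := fun E => by fun_prop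
  have hc : ∀ E ∈ Icc a b, Continuous fun θ => R (θ, E, 0) := fun E hE =>
    continuous_iff_continuousAt.2 fun θ =>
      ContinuousAt.comp (f := fun θ : ℝ => ((θ, E, 0) : ℝ × ℝ × ℝ)) (hR θ E hE).continuousAt
        (hmk E).continuousAt
  obtain ⟨C, -, hC⟩ := exists_bound_of_periodic (R := R) (a := a) (b := b) (ε₁ := 0)
    fun θ E hE ε hε => by
      rw [abs_nonpos_iff.1 hε]
      exact (hR θ E hE).continuousAt
  intro E₀ hE₀
  refine intervalIntegral.continuousWithinAt_of_dominated_interval (μ := volume)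
    (F := fun E θ => R (θ, E, 0)) (bound := fun _ => C) ?_ ?_ intervalIntegrable_const ?_
  · filter_upwards [self_mem_nhdsWithin] with E hE
    exact (hc E hE).aestronglyMeasurable
  · filter_upwards [self_mem_nhdsWithin] with E hE
    refine Eventually.of_forall fun θ hθ => ?_
    rw [uIoc_of_le (by positivity)] at hθ
    exact hC θ (Ioc_subset_Icc_self hθ) E hE 0 (by simp)
  · refine Eventually.of_forall fun θ _ => ?_
    have : ContinuousAt (fun E : ℝ => ((θ, E, 0) : ℝ × ℝ × ℝ)) E₀ := by fun_prop
    exact (ContinuousAt.comp (f := fun E : ℝ => ((θ, E, 0) : ℝ × ℝ × ℝ))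
      (hR θ E₀ hE₀).continuousAt this).continuousWithinAt

/-- A period annulus of the Hamiltonian system with potential `Q ∘ P` which the change of variable
`X = P x` turns into the star-shaped annulus `h₁ < y² / 2 + Q X < h₂`. -/
structure Annulus where
  P : ℝ[X]
  Q : ℝ[X]
  ψ : ℝ → ℝ
  I : Set ℝ
  J : Set ℝ
  lo : ℝ
  h₁ : ℝ
  h₂ : ℝ
  isOpen_I : IsOpen I
  isOpen_J : IsOpen J
  bdd : ∃ B, ∀ x ∈ I, |x| < B
  mapsTo_P : ∀ x ∈ I, P.eval x ∈ J
  mapsTo_ψ : ∀ x ∈ J, ψ x ∈ I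
  left_inv : ∀ x ∈ I, ψ (P.eval x) = x
  right_inv : ∀ x ∈ J, P.eval (ψ x) = x
  contDiffAt_ψ : ∀ x ∈ J, ContDiffAt ℝ 1 ψ x
  sign : (∀ x ∈ I, 0 < P.derivative.eval x) ∨ (∀ x ∈ I, P.derivative.eval x < 0)
  lo_lt : lo < h₁
  lt : h₁ < h₂
  star : StarAbove Q lo
  sub : ∀ x, Q.eval x ≤ h₂ → x ∈ J

namespace Annulus

variable (N : Annulus) (f : ℝ[X])

/-- The open region filled by the annulus in the original coordinates. -/
def region : Set (ℝ × ℝ) :=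
  {p | p.1 ∈ N.I ∧ p.2 ^ 2 / 2 + (N.Q.comp N.P).eval p.1 ∈ Ioo N.h₁ N.h₂}

/-- The damping coefficient in the new coordinates. -/
noncomputable def damping (x : ℝ) : ℝ :=
  f.eval (N.ψ x) / N.P.derivative.eval (N.ψ x)

/-- The radius in polar coordinates. -/
noncomputable def rad (θ h : ℝ) : ℝ := polarRadius N.Q θ h

/-- The position in polar coordinates. -/
noncomputable def pos (θ h : ℝ) : ℝ := N.rad θ h * Real.cos θ

/-- The velocity in polar coordinates. -/
noncomputable def vel (θ h : ℝ) : ℝ := N.rad θ h * Real.sin θ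

/-- The rate of angular motion, up to the factor `-1 / r²`. -/
noncomputable def angular (X y ε : ℝ) : ℝ :=
  X * N.Q.derivative.eval X + y ^ 2 + ε * (N.damping f X * X * y)

/-- The right-hand side of the equation `dE/dθ = ε R(θ, E, ε)` for the energy. -/
noncomputable def rhs (p : ℝ × ℝ × ℝ) : ℝ :=
  N.damping f (N.pos p.1 p.2.1) * N.vel p.1 p.2.1 ^ 2 * N.rad p.1 p.2.1 ^ 2 /
    N.angular f (N.pos p.1 p.2.1) (N.vel p.1 p.2.1) p.2.2

/-- The Melnikov (abelian) integral. -/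
noncomputable def melnikov (h : ℝ) : ℝ := ∫ θ in (0 : ℝ)..2 * Real.pi, N.rhs f (θ, h, 0)

variable {N f}

theorem deriv_ne_zero {x : ℝ} (hx : x ∈ N.I) : N.P.derivative.eval x ≠ 0 := by
  rcases N.sign with h | h
  · exact (h x hx).ne'
  · exact (h x hx).ne

theorem energy_eq {θ h : ℝ} (hh : N.lo ≤ h) :
    N.vel θ h ^ 2 / 2 + N.Q.eval (N.pos θ h) = h :=
  (polarRadius_spec (N.star.mono hh) θ).2

theorem rad_pos {θ h : ℝ} (hh : N.lo ≤ h) : 0 < N.rad θ h :=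
  (polarRadius_spec (N.star.mono hh) θ).1

theorem mem_J {X y h : ℝ} (hh : h ≤ N.h₂) (he : y ^ 2 / 2 + N.Q.eval X = h) : X ∈ N.J :=
  N.sub _ (by nlinarith [sq_nonneg y])

theorem pos_mem {θ h : ℝ} (h1 : N.h₁ ≤ h) (h2 : h ≤ N.h₂) : N.pos θ h ∈ N.J :=
  mem_J h2 (energy_eq (N.lo_lt.le.trans h1))

theorem contDiff_eval (Q : ℝ[X]) : ContDiff ℝ 1 fun x => Q.eval x := by
  simpa using Q.contDiff_aeval (𝕜 := ℝ) 1

theorem contDiffAt_damping {x : ℝ} (hx : x ∈ N.J) : ContDiffAt ℝ 1 (N.damping f) x := by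
  have h := N.contDiffAt_ψ x hx
  exact ((contDiff_eval f).contDiffAt.comp x h).div
    ((contDiff_eval N.P.derivative).contDiffAt.comp x h) (deriv_ne_zero (N.mapsTo_ψ x hx))

theorem angular_zero_pos {X y h : ℝ} (hh : N.h₁ ≤ h) (he : y ^ 2 / 2 + N.Q.eval X = h) :
    2 * (N.h₁ - N.lo) < X * N.Q.derivative.eval X + y ^ 2 := by
  have := N.star.2 X
  linarith

theorem exists_angular_pos (N : Annulus) (f : ℝ[X]) :
    ∃ ε₁ > 0, ∀ ε, |ε| ≤ ε₁ → ∀ X y, y ^ 2 / 2 + N.Q.eval X ∈ Icc N.h₁ N.h₂ →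
      0 < N.angular f X y ε := by
  have hQc : Continuous fun x => N.Q.eval x := N.Q.continuous
  have hK : IsCompact {p : ℝ × ℝ | p.2 ^ 2 / 2 + N.Q.eval p.1 ≤ N.h₂} := by
    obtain ⟨K, hK, hK'⟩ := mem_cocompact.1 (N.star.1.eventually_gt_atTop N.h₂)
    have hK1 : ∀ x, N.Q.eval x ≤ N.h₂ → x ∈ K := by
      intro x hx
      by_contra hxK
      exact absurd (hK' hxK) (not_lt.2 hx)
    obtain ⟨m, hm⟩ : ∃ m, ∀ x, m ≤ N.Q.eval x := by
      obtain ⟨x₀, h₀⟩ := hQc.exists_forall_le N.star.1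
      exact ⟨_, h₀⟩
    refine IsCompact.of_isClosed_subset
      (hK.prod (isCompact_Icc (a := -(2 * (N.h₂ - m) + 1)) (b := 2 * (N.h₂ - m) + 1)))
      (isClosed_le (by fun_prop) continuous_const) ?_
    rintro ⟨x, y⟩ hp
    have hp' : y ^ 2 / 2 + N.Q.eval x ≤ N.h₂ := hp
    refine ⟨hK1 x (by nlinarith [sq_nonneg y]), ?_⟩
    have := hm x
    constructor <;> nlinarith [sq_nonneg (y - 1), sq_nonneg (y + 1)]
  have hc : ContinuousOn (fun p : ℝ × ℝ => N.damping f p.1 * p.1 * p.2)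
      {p : ℝ × ℝ | p.2 ^ 2 / 2 + N.Q.eval p.1 ≤ N.h₂} := by
    rintro ⟨x, y⟩ hp
    have hx : x ∈ N.J := mem_J (h := y ^ 2 / 2 + N.Q.eval x) hp rfl
    have h1 : ContinuousAt (fun p : ℝ × ℝ => N.damping f p.1) (x, y) :=
      ContinuousAt.comp (f := fun p : ℝ × ℝ => p.1) (x := (x, y))
        (contDiffAt_damping (f := f) hx).continuousAt continuousAt_fst
    exact ((h1.mul continuousAt_fst).mul continuousAt_snd).continuousWithinAt
  obtain ⟨C, hC⟩ := hK.exists_bound_of_continuousOn hc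
  have hl := N.lo_lt
  refine ⟨(N.h₁ - N.lo) / (|C| + 1), div_pos (by linarith) (by positivity),
    fun ε hε X y he => ?_⟩
  have h1 := angular_zero_pos he.1 rfl
  have h2 := hC (X, y) he.2
  have h3 : |ε * (N.damping f X * X * y)| ≤ N.h₁ - N.lo := by
    rw [abs_mul]
    calc |ε| * |N.damping f X * X * y| ≤ (N.h₁ - N.lo) / (|C| + 1) * (|C| + 1) := by
          refine mul_le_mul hε ?_ (abs_nonneg _) (div_nonneg (by linarith) (by positivity))
          exact h2.trans ((le_abs_self C).trans (by linarith))
      _ = N.h₁ - N.lo := div_mul_cancel₀ _ (by positivity)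
  have h4 := (abs_le.1 h3).1
  unfold angular
  linarith

theorem contDiffAt_rad {θ h ε : ℝ} (hh : N.lo < h) :
    ContDiffAt ℝ 1 (fun p : ℝ × ℝ × ℝ => N.rad p.1 p.2.1) (θ, h, ε) := by
  have h1 : ContDiffAt ℝ 1 (fun p : ℝ × ℝ × ℝ => (p.1, p.2.1)) (θ, h, ε) := by fun_prop
  exact ContDiffAt.comp (f := fun p : ℝ × ℝ × ℝ => (p.1, p.2.1))
    (g := fun p : ℝ × ℝ => polarRadius N.Q p.1 p.2) (θ, h, ε) (contDiffAt_polarRadius N.star hh) h1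

theorem contDiffAt_rhs {θ h ε : ℝ} (h1 : N.h₁ ≤ h) (h2 : h ≤ N.h₂)
    (ha : 0 < N.angular f (N.pos θ h) (N.vel θ h) ε) :
    ContDiffAt ℝ 1 (N.rhs f) (θ, h, ε) := by
  have hr := contDiffAt_rad (θ := θ) (ε := ε) (N.lo_lt.trans_le h1)
  have hcos : ContDiffAt ℝ 1 (fun p : ℝ × ℝ × ℝ => Real.cos p.1) (θ, h, ε) := by fun_prop
  have hsin : ContDiffAt ℝ 1 (fun p : ℝ × ℝ × ℝ => Real.sin p.1) (θ, h, ε) := by fun_prop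
  have heps : ContDiffAt ℝ 1 (fun p : ℝ × ℝ × ℝ => p.2.2) (θ, h, ε) := by fun_prop
  have hX : ContDiffAt ℝ 1 (fun p : ℝ × ℝ × ℝ => N.pos p.1 p.2.1) (θ, h, ε) := hr.mul hcos
  have hy : ContDiffAt ℝ 1 (fun p : ℝ × ℝ × ℝ => N.vel p.1 p.2.1) (θ, h, ε) := hr.mul hsin
  have hd : ContDiffAt ℝ 1 (fun p : ℝ × ℝ × ℝ => N.damping f (N.pos p.1 p.2.1)) (θ, h, ε) :=
    ContDiffAt.comp (f := fun p : ℝ × ℝ × ℝ => N.pos p.1 p.2.1) (θ, h, ε)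
      (contDiffAt_damping (pos_mem h1 h2)) hX
  have hQ' : ContDiffAt ℝ 1 (fun p : ℝ × ℝ × ℝ => N.Q.derivative.eval (N.pos p.1 p.2.1))
      (θ, h, ε) :=
    ContDiffAt.comp (f := fun p : ℝ × ℝ × ℝ => N.pos p.1 p.2.1) (θ, h, ε)
      (contDiff_eval N.Q.derivative).contDiffAt hX
  exact ((hd.mul (hy.pow 2)).mul (hr.pow 2)).div
    (((hX.mul hQ').add (hy.pow 2)).add (heps.mul ((hd.mul hX).mul hy))) ha.ne'

theorem angular_zero {θ h : ℝ} (h1 : N.h₁ ≤ h) :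
    0 < N.angular f (N.pos θ h) (N.vel θ h) 0 := by
  have h3 := angular_zero_pos h1 (energy_eq (θ := θ) (N.lo_lt.le.trans h1))
  have := N.lo_lt
  simp only [angular, zero_mul, add_zero]
  linarith

theorem contDiffAt_rhs_zero {θ h : ℝ} (hh : h ∈ Icc N.h₁ N.h₂) :
    ContDiffAt ℝ 1 (N.rhs f) (θ, h, 0) :=
  contDiffAt_rhs hh.1 hh.2 (angular_zero hh.1)

theorem continuous_rhs_zero {h : ℝ} (hh : h ∈ Icc N.h₁ N.h₂) :
    Continuous fun θ => N.rhs f (θ, h, 0) := by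
  refine continuous_iff_continuousAt.2 fun θ => ?_
  have : ContinuousAt (fun θ : ℝ => ((θ, h, 0) : ℝ × ℝ × ℝ)) θ := by fun_prop
  exact ContinuousAt.comp (f := fun θ : ℝ => ((θ, h, 0) : ℝ × ℝ × ℝ))
    (contDiffAt_rhs_zero hh).continuousAt this

theorem rhs_periodic (θ h ε : ℝ) : N.rhs f (θ + 2 * Real.pi, h, ε) = N.rhs f (θ, h, ε) := by
  simp [rhs, pos, vel, rad, polarRadius_periodic]

theorem hasDerivAt_melnikov {h : ℝ} (hh : h ∈ Ioo N.h₁ N.h₂) :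
    HasDerivAt (N.melnikov f)
      (∫ θ in (0 : ℝ)..2 * Real.pi, partialE (N.rhs f) (θ, h, 0)) h :=
  hasDerivAt_integral_partialE hh fun _ _ hE => contDiffAt_rhs_zero hE

theorem continuousOn_melnikov : ContinuousOn (N.melnikov f) (Icc N.h₁ N.h₂) :=
  continuousOn_integral_of_contDiffAt fun _ _ hE => contDiffAt_rhs_zero hE

theorem rhs_zero_add (f g : ℝ[X]) (θ h : ℝ) :
    N.rhs (f + g) (θ, h, 0) = N.rhs f (θ, h, 0) + N.rhs g (θ, h, 0) := by
  simp only [rhs, damping, angular, eval_add, zero_mul, add_zero]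
  ring

theorem rhs_zero_C_mul (c : ℝ) (f : ℝ[X]) (θ h : ℝ) :
    N.rhs (C c * f) (θ, h, 0) = c * N.rhs f (θ, h, 0) := by
  simp only [rhs, damping, angular, eval_mul, eval_C, zero_mul, add_zero]
  ring

theorem melnikov_add {h : ℝ} (hh : h ∈ Icc N.h₁ N.h₂) (f g : ℝ[X]) :
    N.melnikov (f + g) h = N.melnikov f h + N.melnikov g h := by
  simp only [melnikov, rhs_zero_add]
  exact intervalIntegral.integral_add ((continuous_rhs_zero hh).intervalIntegrable _ _)
    ((continuous_rhs_zero hh).intervalIntegrable _ _)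

theorem melnikov_C_mul (c : ℝ) (f : ℝ[X]) (h : ℝ) :
    N.melnikov (C c * f) h = c * N.melnikov f h := by
  simp only [melnikov, rhs_zero_C_mul]
  exact intervalIntegral.integral_const_mul _ _

/-- The Melnikov integral of the constant `1` does not vanish. -/
theorem melnikov_one_ne_zero {h : ℝ} (hh : h ∈ Icc N.h₁ N.h₂) : N.melnikov 1 h ≠ 0 := by
  have hr : ∀ θ, 0 < N.rad θ h := fun θ => rad_pos (N.lo_lt.le.trans hh.1)
  have key : ∀ s : ℝ, (∀ x ∈ N.I, 0 < s * N.P.derivative.eval x) →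
      0 < ∫ θ in (0 : ℝ)..2 * Real.pi, s * N.rhs 1 (θ, h, 0) := by
    intro s hs
    have hs' : ∀ θ, 0 < s * N.damping 1 (N.pos θ h) := by
      intro θ
      have h1 := hs _ (N.mapsTo_ψ _ (pos_mem (θ := θ) hh.1 hh.2))
      have h2 := deriv_ne_zero (N.mapsTo_ψ _ (pos_mem (θ := θ) hh.1 hh.2))
      have : s * N.damping 1 (N.pos θ h) = s * N.P.derivative.eval (N.ψ (N.pos θ h)) /
          N.P.derivative.eval (N.ψ (N.pos θ h)) ^ 2 := by
        simp only [damping, eval_one]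
        field_simp
      rw [this]
      positivity
    have he : ∀ θ, s * N.rhs 1 (θ, h, 0) = s * N.damping 1 (N.pos θ h) *
        (N.vel θ h ^ 2 * N.rad θ h ^ 2 / N.angular 1 (N.pos θ h) (N.vel θ h) 0) := by
      intro θ
      simp only [rhs]
      ring
    refine intervalIntegral.integral_pos (by positivity)
      (continuous_const.mul (continuous_rhs_zero hh)).continuousOn (fun θ _ => ?_)
      ⟨Real.pi / 2, ⟨by positivity, by linarith [Real.pi_pos]⟩, ?_⟩
    · rw [he]
      have := angular_zero (f := 1) (θ := θ) hh.1
      exact mul_nonneg (hs' θ).le (by positivity)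
    · rw [he]
      have h1 := angular_zero (f := 1) (θ := Real.pi / 2) hh.1
      have h2 := hr (Real.pi / 2)
      have h3 : 0 < N.vel (Real.pi / 2) h := by simpa [vel] using h2
      exact mul_pos (hs' _) (by positivity)
  intro h0
  rcases N.sign with hs | hs
  · have := key 1 (by simpa using hs)
    rw [intervalIntegral.integral_const_mul] at this
    change 0 < 1 * N.melnikov 1 h at this
    simp [h0] at this
  · have := key (-1) (by simpa using hs)
    rw [intervalIntegral.integral_const_mul] at this
    change 0 < -1 * N.melnikov 1 h at this
    simp [h0] at this

end Annulus

/-- A function with nonvanishing derivative of constant sign that commutes with a translation up to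
a shift is a diffeomorphism of the line. -/
theorem exists_inverse_of_quasiperiodic {φ φ' : ℝ → ℝ} {T L : ℝ}
    (hφ : ∀ t, HasDerivAt φ (φ' t) t) (hs : (∀ t, 0 < φ' t) ∨ (∀ t, φ' t < 0)) (hT : T ≠ 0)
    (hp : ∀ t, φ (t + T) = φ t + L) :
    L ≠ 0 ∧ ∃ σ : ℝ → ℝ, (∀ s, φ (σ s) = s) ∧ (∀ t, σ (φ t) = t) ∧ (∀ s, σ (s + L) = σ s + T) ∧
      ∀ s, HasDerivAt σ (φ' (σ s))⁻¹ s := by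
  wlog hpos : ∀ t, 0 < φ' t generalizing φ φ' L
  · have hneg : ∀ t, φ' t < 0 := hs.resolve_left hpos
    obtain ⟨hL, σ, h1, h2, h3, h4⟩ := this (φ := fun t => -φ t) (φ' := fun t => -φ' t) (L := -L)
      (fun t => (hφ t).neg) (Or.inl fun t => neg_pos.2 (hneg t)) (fun t => by rw [hp]; ring)
      (fun t => neg_pos.2 (hneg t))
    refine ⟨neg_ne_zero.1 hL, fun s => σ (-s), fun s => ?_, h2, fun s => ?_, fun s => ?_⟩
    · have := h1 (-s)
      simpa using this
    · have := h3 (-s)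
      simpa [neg_add, add_comm] using this
    · have := (h4 (-s)).comp s (hasDerivAt_neg s)
      refine this.congr_deriv ?_
      simp
  have hmono : StrictMono φ := strictMono_of_deriv_pos fun t => by rw [(hφ t).deriv]; exact hpos t
  have hcont : Continuous φ := continuous_iff_continuousAt.2 fun t => (hφ t).continuousAt
  have hL : L ≠ 0 := by
    rintro rfl
    exact hT (by simpa using hmono.injective ((hp 0).trans (add_zero _)))
  have hper : Function.Periodic (fun t => φ t - L / T * t) T := by
    intro t
    simp only [hp]
    field_simp
    ring
  have hint : ∀ n : ℤ, φ (n * T) = φ 0 + n * L := by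
    intro n
    have h := hper.int_mul n 0
    simp only [zero_add, mul_zero, sub_zero] at h
    have h2 : L / T * (n * T) = n * L := by field_simp
    linarith
  have hunb : ∀ b : ℝ, ∃ n : ℤ, b ≤ n * L := by
    intro b
    rcases lt_or_gt_of_ne hL with h | h
    · exact ⟨⌊b / L⌋, by have := Int.floor_le (b / L); rwa [le_div_iff_of_neg h] at this⟩
    · exact ⟨⌈b / L⌉, by have := Int.le_ceil (b / L); rwa [div_le_iff₀ h] at this⟩
  have hsurj : Function.Surjective φ := by
    intro s
    refine mem_range_of_exists_le_of_exists_ge hcont ?_ ?_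
    · obtain ⟨n, hn⟩ := hunb (φ 0 - s)
      refine ⟨((-n : ℤ) : ℝ) * T, ?_⟩
      rw [hint]
      push_cast
      linarith
    · obtain ⟨n, hn⟩ := hunb (s - φ 0)
      exact ⟨n * T, by rw [hint]; linarith⟩
  set o := hmono.orderIsoOfSurjective φ hsurj with ho
  have h1 : ∀ s, φ (o.symm s) = s := fun s => o.apply_symm_apply s
  have h2 : ∀ t, o.symm (φ t) = t := fun t => o.symm_apply_apply t
  refine ⟨hL, o.symm, h1, h2, fun s => ?_, fun s => ?_⟩
  · apply hmono.injective
    rw [h1, hp, h1]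
  · exact HasDerivAt.of_local_left_inverse o.symm.continuous.continuousAt (hφ _) (hpos _).ne'
      (Eventually.of_forall h1)

/-- A closed curve tangent to a vector field, with a proportionality factor of constant sign,
is a periodic orbit. -/
theorem isPeriodicOrbit_of_tangent {V : ℝ × ℝ → ℝ × ℝ} {c : ℝ → ℝ × ℝ} {τ : ℝ → ℝ} {L : ℝ}
    (hL : 0 < L) (hτc : Continuous τ) (hs : (∀ θ, 0 < τ θ) ∨ (∀ θ, τ θ < 0))
    (hτp : Function.Periodic τ L) (hcp : Function.Periodic c L)
    (hc : ∀ θ, HasDerivAt c (τ θ • V (c θ)) θ) (hne : ∃ a b, c a ≠ c b) :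
    IsPeriodicOrbit V (range c) := by
  set φ : ℝ → ℝ := fun θ => ∫ u in (0 : ℝ)..θ, τ u with hφ
  have hd : ∀ θ, HasDerivAt φ (τ θ) θ := fun θ => hτc.integral_hasStrictDerivAt 0 θ |>.hasDerivAt
  have hp : ∀ θ, φ (θ + L) = φ θ + ∫ u in (0 : ℝ)..L, τ u := by
    intro θ
    have h1 : φ (θ + L) = φ θ + ∫ u in θ..θ + L, τ u :=
      (intervalIntegral.integral_add_adjacent_intervals (hτc.intervalIntegrable _ _)
        (hτc.intervalIntegrable _ _)).symm
    rw [h1, hτp.intervalIntegral_add_eq θ 0, zero_add]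
  obtain ⟨hT, σ, h1, h2, h3, h4⟩ := exists_inverse_of_quasiperiodic hd hs hL.ne' hp
  set T := ∫ u in (0 : ℝ)..L, τ u with hTdef
  have hτ0 : ∀ θ, τ θ ≠ 0 := fun θ => by
    rcases hs with hs | hs
    · exact (hs θ).ne'
    · exact (hs θ).ne
  have hper : Function.Periodic (fun t => c (σ t)) T := fun t => by simp only [h3, hcp (σ t)]
  refine ⟨fun t => c (σ t), fun t => ?_, ⟨|T|, abs_pos.2 hT, ?_⟩, ?_, ?_⟩
  · have := HasDerivAt.scomp t (hc (σ t)) (h4 t)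
    refine this.congr_deriv ?_
    rw [smul_smul, inv_mul_cancel₀ (hτ0 _), one_smul]
  · rcases abs_choice T with h | h <;> rw [h]
    · exact hper
    · exact hper.neg
  · obtain ⟨a, b, hab⟩ := hne
    exact ⟨φ a, φ b, by simpa only [h2] using hab⟩
  · ext p
    constructor
    · rintro ⟨θ, rfl⟩
      exact ⟨φ θ, by simp only [h2]⟩
    · rintro ⟨t, rfl⟩
      exact ⟨σ t, rfl⟩

/-- A nowhere vanishing planar curve has a differentiable polar angle. -/
theorem exists_polar_angle {X y X' y' : ℝ → ℝ} (hX : ∀ t, HasDerivAt X (X' t) t)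
    (hy : ∀ t, HasDerivAt y (y' t) t) (hX' : Continuous X') (hy' : Continuous y')
    (hne : ∀ t, 0 < X t ^ 2 + y t ^ 2) :
    ∃ θ : ℝ → ℝ, (∀ t, HasDerivAt θ ((X t * y' t - y t * X' t) / (X t ^ 2 + y t ^ 2)) t) ∧
      ∀ t, X t = √(X t ^ 2 + y t ^ 2) * Real.cos (θ t) ∧
        y t = √(X t ^ 2 + y t ^ 2) * Real.sin (θ t) := by
  have hXc : Continuous X := continuous_iff_continuousAt.2 fun t => (hX t).continuousAt
  have hyc : Continuous y := continuous_iff_continuousAt.2 fun t => (hy t).continuousAt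
  set ω : ℝ → ℝ := fun t => (X t * y' t - y t * X' t) / (X t ^ 2 + y t ^ 2) with hω
  have hωc : Continuous ω := by
    refine Continuous.div (by fun_prop) (by fun_prop) fun t => (hne t).ne'
  set z : ℂ := ⟨X 0, y 0⟩ with hz
  set θ : ℝ → ℝ := fun t => z.arg + ∫ u in (0 : ℝ)..t, ω u with hθ
  have hθd : ∀ t, HasDerivAt θ (ω t) t := fun t =>
    (hωc.integral_hasStrictDerivAt 0 t).hasDerivAt.const_add _
  have hθ0 : θ 0 = z.arg := by simp [hθ]
  set r : ℝ → ℝ := fun t => √(X t ^ 2 + y t ^ 2) with hr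
  have hrpos : ∀ t, 0 < r t := fun t => Real.sqrt_pos.2 (hne t)
  have hrsq : ∀ t, r t ^ 2 = X t ^ 2 + y t ^ 2 := fun t => Real.sq_sqrt (hne t).le
  have hz0 : ‖z‖ = r 0 := by
    rw [Complex.norm_def, Complex.normSq_apply]
    simp [hr, hz, sq]
  have hrd : ∀ t, HasDerivAt r ((X t * X' t + y t * y' t) / r t) t := by
    intro t
    have := (((hX t).pow 2).add ((hy t).pow 2)).sqrt (hne t).ne'
    refine this.congr_deriv ?_
    change _ / (2 * r t) = _
    have := (hrpos t).ne'
    field_simp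
    norm_num
    ring
  have hcos := fun t => (hθd t).cos
  have hsin := fun t => (hθd t).sin
  have ha : ∀ t, HasDerivAt (fun t => (X t * Real.cos (θ t) + y t * Real.sin (θ t)) / r t) 0 t := by
    intro t
    refine ((((hX t).mul (hcos t)).add ((hy t).mul (hsin t))).div (hrd t)
      (hrpos t).ne').congr_deriv ?_
    have h0 := (hrpos t).ne'
    have h1 := hrsq t
    have h2 := (hne t).ne'
    simp only [hω, Pi.add_apply, Pi.mul_apply]
    rw [← h1]
    field_simp
    rw [h1]
    ring
  have hb : ∀ t, HasDerivAt (fun t => (y t * Real.cos (θ t) - X t * Real.sin (θ t)) / r t) 0 t := by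
    intro t
    refine ((((hy t).mul (hcos t)).sub ((hX t).mul (hsin t))).div (hrd t)
      (hrpos t).ne').congr_deriv ?_
    have h0 := (hrpos t).ne'
    have h1 := hrsq t
    simp only [hω, Pi.sub_apply, Pi.mul_apply]
    rw [← h1]
    field_simp
    rw [h1]
    ring
  have ha1 := fun t => is_const_of_deriv_eq_zero (fun t => (ha t).differentiableAt)
    (fun t => (ha t).deriv) t 0
  have hb1 := fun t => is_const_of_deriv_eq_zero (fun t => (hb t).differentiableAt)
    (fun t => (hb t).deriv) t 0
  have hx0 : X 0 = r 0 * Real.cos z.arg := by rw [← hz0, Complex.norm_mul_cos_arg]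
  have hy0 : y 0 = r 0 * Real.sin z.arg := by rw [← hz0, Complex.norm_mul_sin_arg]
  refine ⟨θ, hθd, fun t => ?_⟩
  have ha2 := ha1 t
  have hb2 := hb1 t
  simp only [hθ0] at ha2 hb2
  have hr0 := (hrpos 0).ne'
  have hrt := (hrpos t).ne'
  have e1 : (X 0 * Real.cos z.arg + y 0 * Real.sin z.arg) / r 0 = 1 := by
    rw [div_eq_one_iff_eq hr0, hx0, hy0]
    linear_combination (r 0) * Real.sin_sq_add_cos_sq z.arg
  have e2 : (y 0 * Real.cos z.arg - X 0 * Real.sin z.arg) / r 0 = 0 := by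
    rw [div_eq_zero_iff, hx0, hy0]
    left
    ring
  rw [e1, div_eq_one_iff_eq hrt] at ha2
  rw [e2, div_eq_zero_iff, or_iff_left hrt] at hb2
  have := Real.sin_sq_add_cos_sq (θ t)
  constructor
  · change X t = r t * _
    linear_combination (Real.cos (θ t)) * ha2 - Real.sin (θ t) * hb2 - X t * this
  · change y t = r t * _
    linear_combination (Real.sin (θ t)) * ha2 + Real.cos (θ t) * hb2 - y t * this

namespace Annulus

variable {N : Annulus} {f : ℝ[X]}

theorem hasDerivAt_ψ {x : ℝ} (hx : x ∈ N.J) :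
    HasDerivAt N.ψ (N.P.derivative.eval (N.ψ x))⁻¹ x := by
  refine HasDerivAt.of_local_left_inverse (N.contDiffAt_ψ x hx).continuousAt
    (N.P.hasDerivAt (N.ψ x)) (deriv_ne_zero (N.mapsTo_ψ x hx)) ?_
  filter_upwards [N.isOpen_J.mem_nhds hx] with x' hx'
  exact N.right_inv x' hx'

theorem pos_sq_add_vel_sq (θ h : ℝ) : N.pos θ h ^ 2 + N.vel θ h ^ 2 = N.rad θ h ^ 2 := by
  simp only [pos, vel]
  linear_combination N.rad θ h ^ 2 * Real.sin_sq_add_cos_sq θ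

/-- Cartesian form of the equation for the energy. -/
theorem hasDerivAt_pos_vel {e : ℝ → ℝ} {θ ε : ℝ} (he : e θ ∈ Icc N.h₁ N.h₂)
    (hd : HasDerivAt e (ε * N.rhs f (θ, e θ, ε)) θ)
    (ha : 0 < N.angular f (N.pos θ (e θ)) (N.vel θ (e θ)) ε) :
    HasDerivAt (fun s => N.pos s (e s))
      (-(N.rad θ (e θ) ^ 2 / N.angular f (N.pos θ (e θ)) (N.vel θ (e θ)) ε) *
        N.vel θ (e θ)) θ ∧
    HasDerivAt (fun s => N.vel s (e s))
      (-(N.rad θ (e θ) ^ 2 / N.angular f (N.pos θ (e θ)) (N.vel θ (e θ)) ε) *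
        (-N.Q.derivative.eval (N.pos θ (e θ)) -
          ε * N.damping f (N.pos θ (e θ)) * N.vel θ (e θ))) θ := by
  have hlo : N.lo < e θ := N.lo_lt.trans_le he.1
  have hr : 0 < N.rad θ (e θ) := rad_pos hlo.le
  have hrd : DifferentiableAt ℝ (fun s => N.rad s (e s)) θ := by
    have h1 : DifferentiableAt ℝ (fun s => (s, e s)) θ :=
      differentiableAt_id.prodMk hd.differentiableAt
    exact DifferentiableAt.comp (f := fun s => (s, e s))
      (g := fun p : ℝ × ℝ => polarRadius N.Q p.1 p.2) θ
      ((contDiffAt_polarRadius N.star hlo).differentiableAt one_ne_zero) h1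
  set r' := deriv (fun s => N.rad s (e s)) θ with hr'
  have hX := hrd.hasDerivAt.mul (Real.hasDerivAt_cos θ)
  have hy := hrd.hasDerivAt.mul (Real.hasDerivAt_sin θ)
  change HasDerivAt (fun s => N.pos s (e s)) _ θ at hX
  change HasDerivAt (fun s => N.vel s (e s)) _ θ at hy
  have hE := ((hy.pow 2).div_const 2).add ((N.Q.hasDerivAt (N.pos θ (e θ))).comp θ hX)
  have hev : (fun s => N.vel s (e s) ^ 2 / 2 + N.Q.eval (N.pos s (e s))) =ᶠ[𝓝 θ] e := by
    filter_upwards [hd.continuousAt.eventually (lt_mem_nhds hlo)] with s hs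
    exact energy_eq hs.le
  have hE' := (hd.congr_of_eventuallyEq hev).unique hE
  simp only [Nat.cast_ofNat, Nat.add_one_sub_one, pow_one] at hE'
  have hA : N.angular f (N.pos θ (e θ)) (N.vel θ (e θ)) ε =
    N.pos θ (e θ) * N.Q.derivative.eval (N.pos θ (e θ)) + N.vel θ (e θ) ^ 2 +
      ε * (N.damping f (N.pos θ (e θ)) * N.pos θ (e θ) * N.vel θ (e θ)) := rfl
  have hR : N.rhs f (θ, e θ, ε) = N.damping f (N.pos θ (e θ)) * N.vel θ (e θ) ^ 2 *
    N.rad θ (e θ) ^ 2 / N.angular f (N.pos θ (e θ)) (N.vel θ (e θ)) ε := rfl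
  have hD := angular_zero_pos he.1 (energy_eq (θ := θ) hlo.le)
  have hl := N.lo_lt
  have hsq := pos_sq_add_vel_sq (N := N) θ (e θ)
  have hXdef : N.pos θ (e θ) = N.rad θ (e θ) * Real.cos θ := rfl
  have hydef : N.vel θ (e θ) = N.rad θ (e θ) * Real.sin θ := rfl
  rw [hR] at hE'
  set A := N.angular f (N.pos θ (e θ)) (N.vel θ (e θ)) ε
  set X := N.pos θ (e θ)
  set y := N.vel θ (e θ)
  set r := N.rad θ (e θ)
  set d := N.damping f X
  set q := N.Q.derivative.eval X
  have hDpos : 0 < X * q + y ^ 2 := by linarith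
  have hA0 := ha.ne'
  have hD0 := hDpos.ne'
  have hr0 := hr.ne'
  have key : r' * (X * q + y ^ 2) = r * (ε * (d * y ^ 2 * r ^ 2 / A) - y * (X - q)) := by
    rw [hE']
    simp only [hXdef, hydef]
    ring
  have key' : A * (r' * (X * q + y ^ 2)) = r * (ε * (d * y ^ 2 * r ^ 2) - A * (y * (X - q))) := by
    rw [key]
    field_simp
  constructor
  · refine hX.congr_deriv ?_
    apply mul_left_cancel₀ (mul_ne_zero (mul_ne_zero hr0 hD0) hA0)
    have e1 : r * (X * q + y ^ 2) * A * (r' * Real.cos θ + r * -Real.sin θ) =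
        A * (r' * (X * q + y ^ 2)) * X - r * A * (X * q + y ^ 2) * y := by
      simp only [hXdef, hydef]; ring
    have e2 : r * (X * q + y ^ 2) * A * (-(r ^ 2 / A) * y) =
      -(r * (X * q + y ^ 2) * r ^ 2 * y) := by field_simp
    change r * (X * q + y ^ 2) * A * (r' * Real.cos θ + r * -Real.sin θ) = _
    rw [e1, e2, key', ← hsq, hA]
    ring
  · refine hy.congr_deriv ?_
    apply mul_left_cancel₀ (mul_ne_zero (mul_ne_zero hr0 hD0) hA0)
    have e1 : r * (X * q + y ^ 2) * A * (r' * Real.sin θ + r * Real.cos θ) =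
        A * (r' * (X * q + y ^ 2)) * y + r * A * (X * q + y ^ 2) * X := by
      simp only [hXdef, hydef]; ring
    have e2 : r * (X * q + y ^ 2) * A * (-(r ^ 2 / A) * (-q - ε * d * y)) =
      r * (X * q + y ^ 2) * r ^ 2 * (q + ε * d * y) := by field_simp; ring
    change r * (X * q + y ^ 2) * A * (r' * Real.sin θ + r * Real.cos θ) = _
    rw [e1, e2, key', ← hsq, hA]
    ring

/-- The closed curve with energy `e θ` at angle `θ`. -/
noncomputable def curve (N : Annulus) (e : ℝ → ℝ) (θ : ℝ) : ℝ × ℝ :=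
  (N.ψ (N.pos θ (e θ)), N.vel θ (e θ))

theorem energy_ψ {X : ℝ} (hX : X ∈ N.J) : (N.Q.comp N.P).eval (N.ψ X) = N.Q.eval X := by
  rw [eval_comp, N.right_inv X hX]

theorem energy_curve {e : ℝ → ℝ} {θ : ℝ} (he : e θ ∈ Icc N.h₁ N.h₂) :
    (N.curve e θ).1 ∈ N.I ∧
      (N.curve e θ).2 ^ 2 / 2 + (N.Q.comp N.P).eval (N.curve e θ).1 = e θ := by
  have hX : N.pos θ (e θ) ∈ N.J := pos_mem he.1 he.2
  refine ⟨N.mapsTo_ψ _ hX, ?_⟩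
  simp only [curve, energy_ψ hX]
  exact energy_eq (N.lo_lt.le.trans he.1)

theorem isPeriodicOrbit_curve {e : ℝ → ℝ} {ε : ℝ} (hper : Function.Periodic e (2 * Real.pi))
    (he : ∀ θ, e θ ∈ Icc N.h₁ N.h₂) (hd : ∀ θ, HasDerivAt e (ε * N.rhs f (θ, e θ, ε)) θ)
    (ha : ∀ X y, y ^ 2 / 2 + N.Q.eval X ∈ Icc N.h₁ N.h₂ → 0 < N.angular f X y ε) :
    IsPeriodicOrbit (lienard f (N.Q.comp N.P).derivative ε) (range (N.curve e)) := by
  have hlo : ∀ θ, N.lo ≤ e θ := fun θ => N.lo_lt.le.trans (he θ).1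
  have hA : ∀ θ, 0 < N.angular f (N.pos θ (e θ)) (N.vel θ (e θ)) ε := fun θ =>
    ha _ _ (by rw [energy_eq (hlo θ)]; exact he θ)
  have hJ : ∀ θ, N.pos θ (e θ) ∈ N.J := fun θ => pos_mem (he θ).1 (he θ).2
  have hI : ∀ θ, N.ψ (N.pos θ (e θ)) ∈ N.I := fun θ => N.mapsTo_ψ _ (hJ θ)
  have hXy := fun θ => hasDerivAt_pos_vel (he θ) (hd θ) (hA θ)
  have hec : Continuous e := continuous_iff_continuousAt.2 fun θ => (hd θ).continuousAt
  have hXc : Continuous fun θ => N.pos θ (e θ) :=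
    continuous_iff_continuousAt.2 fun θ => (hXy θ).1.continuousAt
  have hyc : Continuous fun θ => N.vel θ (e θ) :=
    continuous_iff_continuousAt.2 fun θ => (hXy θ).2.continuousAt
  have hψc : Continuous fun θ => N.ψ (N.pos θ (e θ)) :=
    continuous_iff_continuousAt.2 fun θ =>
      ContinuousAt.comp (f := fun θ => N.pos θ (e θ)) (N.contDiffAt_ψ _ (hJ θ)).continuousAt
        hXc.continuousAt
  have hdc : Continuous fun θ => N.damping f (N.pos θ (e θ)) :=
    continuous_iff_continuousAt.2 fun θ =>
      ContinuousAt.comp (f := fun θ => N.pos θ (e θ))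
        (contDiffAt_damping (hJ θ)).continuousAt hXc.continuousAt
  have hAc : Continuous fun θ => N.angular f (N.pos θ (e θ)) (N.vel θ (e θ)) ε := by
    have := N.Q.derivative.continuous.comp hXc
    exact (((hXc.mul this).add (hyc.pow 2)).add (((hdc.mul hXc).mul hyc).const_mul ε) :)
  have hrc : Continuous fun θ => N.rad θ (e θ) ^ 2 :=
    ((hXc.pow 2).add (hyc.pow 2)).congr fun θ => pos_sq_add_vel_sq θ (e θ)
  have hP0 : ∀ θ, N.P.derivative.eval (N.ψ (N.pos θ (e θ))) ≠ 0 := fun θ => deriv_ne_zero (hI θ)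
  have hr : ∀ θ, 0 < N.rad θ (e θ) := fun θ => rad_pos (hlo θ)
  refine isPeriodicOrbit_of_tangent (L := 2 * Real.pi)
    (τ := fun θ => -(N.rad θ (e θ) ^ 2 / N.angular f (N.pos θ (e θ)) (N.vel θ (e θ)) ε) *
      (N.P.derivative.eval (N.ψ (N.pos θ (e θ))))⁻¹) (by positivity) ?_ ?_ ?_ ?_ ?_ ?_
  · exact (hrc.div hAc fun θ => (hA θ).ne').neg.mul
      ((N.P.derivative.continuous.comp hψc).inv₀ hP0)
  · rcases N.sign with hs | hs
    · exact Or.inr fun θ => mul_neg_of_neg_of_pos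
        (neg_lt_zero.2 (div_pos (pow_pos (hr θ) 2) (hA θ))) (inv_pos.2 (hs _ (hI θ)))
    · exact Or.inl fun θ => mul_pos_of_neg_of_neg
        (neg_lt_zero.2 (div_pos (pow_pos (hr θ) 2) (hA θ))) (inv_lt_zero.2 (hs _ (hI θ)))
  · intro θ
    simp [pos, vel, rad, polarRadius_periodic, hper θ]
  · intro θ
    simp [curve, pos, vel, rad, polarRadius_periodic, hper θ]
  · intro θ
    have h1 := ((hasDerivAt_ψ (hJ θ)).comp θ (hXy θ).1).prodMk (hXy θ).2
    refine h1.congr_deriv ?_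
    have h2 := hP0 θ
    simp only [lienard, curve, derivative_comp, eval_mul, eval_comp, N.right_inv _ (hJ θ),
      Prod.smul_mk, smul_eq_mul, damping]
    refine Prod.ext ?_ ?_
    · simp only
      ring
    · simp only
      field_simp
  · refine ⟨Real.pi / 2, -(Real.pi / 2), fun h => ?_⟩
    have h1 := congrArg Prod.snd h
    simp only [curve, vel, Real.sin_neg, Real.sin_pi_div_two] at h1
    have h2 := hr (Real.pi / 2)
    have h3 := hr (-(Real.pi / 2))
    linarith

/-- A periodic orbit inside the annulus comes from a periodic solution of the energy equation. -/
theorem exists_periodic_solution_of_isPeriodicOrbit {ε a b : ℝ} {Γ : Set (ℝ × ℝ)}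
    (hab : Ioo a b ⊆ Icc N.h₁ N.h₂)
    (ha : ∀ X y, y ^ 2 / 2 + N.Q.eval X ∈ Icc N.h₁ N.h₂ → 0 < N.angular f X y ε)
    (hΓ : IsPeriodicOrbit (lienard f (N.Q.comp N.P).derivative ε) Γ)
    (hsub : Γ ⊆ {p | p.1 ∈ N.I ∧ p.2 ^ 2 / 2 + (N.Q.comp N.P).eval p.1 ∈ Ioo a b}) :
    ∃ e : ℝ → ℝ, (∀ θ, e θ ∈ Ioo a b) ∧ (∀ θ, HasDerivAt e (ε * N.rhs f (θ, e θ, ε)) θ) ∧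
      (∃ k : ℕ, 0 < k ∧ Function.Periodic e (k * (2 * Real.pi))) ∧ Γ = range (N.curve e) := by
  obtain ⟨γ, hγ, ⟨T, hT, hTper⟩, -, rfl⟩ := hΓ
  have hmem : ∀ t, (γ t).1 ∈ N.I ∧ (γ t).2 ^ 2 / 2 + N.Q.eval (N.P.eval (γ t).1) ∈ Ioo a b := by
    intro t
    have := hsub (mem_range_self t)
    simpa [eval_comp] using this
  have hγc : Continuous γ := continuous_iff_continuousAt.2 fun t => (hγ t).continuousAt
  have h1 : ∀ t, HasDerivAt (fun t => (γ t).1) (γ t).2 t := fun t =>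
    (hasFDerivAt_fst (𝕜 := ℝ) (p := γ t)).comp_hasDerivAt t (hγ t)
  have h2 : ∀ t, HasDerivAt (fun t => (γ t).2) (-((N.Q.comp N.P).derivative.eval (γ t).1) -
      ε * f.eval (γ t).1 * (γ t).2) t := fun t =>
    (hasFDerivAt_snd (𝕜 := ℝ) (p := γ t)).comp_hasDerivAt t (hγ t)
  set X : ℝ → ℝ := fun t => N.P.eval (γ t).1 with hXdef
  set y : ℝ → ℝ := fun t => (γ t).2 with hydef
  set p : ℝ → ℝ := fun t => N.P.derivative.eval (γ t).1 with hpdef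
  have hJ : ∀ t, X t ∈ N.J := fun t => N.mapsTo_P _ (hmem t).1
  have hψX : ∀ t, N.ψ (X t) = (γ t).1 := fun t => N.left_inv _ (hmem t).1
  have hp0 : ∀ t, p t ≠ 0 := fun t => deriv_ne_zero (hmem t).1
  set X' : ℝ → ℝ := fun t => p t * y t with hX'def
  set y' : ℝ → ℝ := fun t => -((N.Q.comp N.P).derivative.eval (γ t).1) -
      ε * f.eval (γ t).1 * (γ t).2 with hy'def
  have hX : ∀ t, HasDerivAt X (X' t) t := fun t =>
    HasDerivAt.comp (h₂ := fun x => N.P.eval x) t (N.P.hasDerivAt (γ t).1) (h1 t)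
  have hg1 : Continuous fun t => (γ t).1 := hγc.fst
  have hyc : Continuous y := hγc.snd
  have hpc : Continuous p := N.P.derivative.continuous.comp hg1
  have hX'c : Continuous X' := hpc.mul hyc
  have hy'c : Continuous y' :=
    ((N.Q.comp N.P).derivative.continuous.comp hg1).neg.sub
      (((f.continuous.comp hg1).const_mul ε).mul hyc)
  have hy'eq : ∀ t, y' t = p t * (-N.Q.derivative.eval (X t) - ε * N.damping f (X t) * y t) := by
    intro t
    have := hp0 t
    simp only [hy'def, damping, hψX, derivative_comp, eval_mul, eval_comp]
    simp only [hpdef, hXdef, hydef] at this ⊢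
    field_simp
  have hE : ∀ t, y t ^ 2 / 2 + N.Q.eval (X t) ∈ Icc N.h₁ N.h₂ := fun t => hab (hmem t).2
  have hA : ∀ t, 0 < N.angular f (X t) (y t) ε := fun t => ha _ _ (hE t)
  have hD : ∀ t, 0 < X t * N.Q.derivative.eval (X t) + y t ^ 2 := by
    intro t
    have := angular_zero_pos (hE t).1 rfl
    have := N.lo_lt
    linarith
  have hne : ∀ t, 0 < X t ^ 2 + y t ^ 2 := by
    intro t
    by_contra h
    have hy0 : y t = 0 := by nlinarith [sq_nonneg (X t), sq_nonneg (y t)]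
    have hX0 : X t = 0 := by nlinarith [sq_nonneg (X t), sq_nonneg (y t)]
    have := hD t
    simp [hX0, hy0] at this
  obtain ⟨θ, hθd, hθ⟩ := exists_polar_angle hX h2 hX'c hy'c hne
  set E : ℝ → ℝ := fun t => y t ^ 2 / 2 + N.Q.eval (X t) with hEdef
  have hrad : ∀ t, N.rad (θ t) (E t) = √(X t ^ 2 + y t ^ 2) := by
    intro t
    refine polarRadius_eq (N.star.mono (N.lo_lt.le.trans (hE t).1)) (Real.sqrt_pos.2 (hne t)) ?_
    rw [polarEnergy, ← (hθ t).1, ← (hθ t).2]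
  have hpos : ∀ t, N.pos (θ t) (E t) = X t := fun t => by rw [pos, hrad, ← (hθ t).1]
  have hvel : ∀ t, N.vel (θ t) (E t) = y t := fun t => by
    rw [vel, hrad]
    exact (hθ t).2.symm
  have hrsq : ∀ t, N.rad (θ t) (E t) ^ 2 = X t ^ 2 + y t ^ 2 := fun t => by
    rw [hrad, Real.sq_sqrt (hne t).le]
  have hθd' : ∀ t, HasDerivAt θ (-(p t * N.angular f (X t) (y t) ε / (X t ^ 2 + y t ^ 2))) t := by
    intro t
    refine (hθd t).congr_deriv ?_
    change (X t * y' t - y t * X' t) / (X t ^ 2 + y t ^ 2) = _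
    rw [hy'eq, angular]
    simp only [hX'def]
    ring
  have hsign : (∀ t, 0 < -(p t * N.angular f (X t) (y t) ε / (X t ^ 2 + y t ^ 2))) ∨
      (∀ t, -(p t * N.angular f (X t) (y t) ε / (X t ^ 2 + y t ^ 2)) < 0) := by
    rcases N.sign with hs | hs
    · right
      intro t
      have : 0 < p t := hs _ (hmem t).1
      have := hA t
      have := hne t
      rw [neg_lt_zero]
      positivity
    · left
      intro t
      have h : p t < 0 := hs _ (hmem t).1
      rw [neg_pos]
      exact div_neg_of_neg_of_pos (mul_neg_of_neg_of_pos h (hA t)) (hne t)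
  have hXT : ∀ t, X (t + T) = X t := fun t => by simp only [hXdef, hTper t]
  have hyT : ∀ t, y (t + T) = y t := fun t => by simp only [hydef, hTper t]
  have hpT : ∀ t, p (t + T) = p t := fun t => by simp only [hpdef, hTper t]
  have hET : ∀ t, E (t + T) = E t := fun t => by simp only [hEdef, hXT, hyT]
  obtain ⟨L, hL⟩ : ∃ L, ∀ t, θ (t + T) = θ t + L := by
    refine ⟨θ (0 + T) - θ 0, fun t => ?_⟩
    have hd : ∀ t, HasDerivAt (fun t => θ (t + T) - θ t) 0 t := by
      intro t
      refine (((hθd' (t + T)).comp_add_const t T).sub (hθd' t)).congr_deriv ?_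
      rw [hpT, hXT, hyT, sub_self]
    have := is_const_of_deriv_eq_zero (fun t => (hd t).differentiableAt) (fun t => (hd t).deriv) t 0
    linarith
  obtain ⟨hL0, σ, hs1, hs2, hs3, hs4⟩ :=
    exists_inverse_of_quasiperiodic hθd' hsign hT.ne' hL
  have hE' : ∀ t, HasDerivAt E (-(p t * (ε * N.damping f (X t) * y t ^ 2))) t := by
    intro t
    refine ((((h2 t).pow 2).div_const 2).add ((N.Q.hasDerivAt (X t)).comp t (hX t))).congr_deriv ?_
    change (2 : ℕ) * y t ^ (2 - 1) * y' t / 2 + _ = _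
    rw [hy'eq]
    simp only [hX'def, Nat.cast_ofNat, Nat.add_one_sub_one, pow_one]
    ring
  refine ⟨fun s => E (σ s), fun s => (hmem _).2, fun s => ?_, ?_, ?_⟩
  · refine ((hE' (σ s)).comp s (hs4 s)).congr_deriv ?_
    have e1 := hpos (σ s)
    have e2 := hvel (σ s)
    have e3 := hrsq (σ s)
    rw [hs1] at e1 e2 e3
    simp only [rhs, e1, e2, e3]
    have := hp0 (σ s)
    have := (hA (σ s)).ne'
    have := (hne (σ s)).ne'
    field_simp
  · have hpd : Function.Periodic (fun s => E (σ s)) L := fun s => by simp only [hs3, hET]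
    have hr : ∀ t, √(X (t + T) ^ 2 + y (t + T) ^ 2) = √(X t ^ 2 + y t ^ 2) := fun t => by
      rw [hXT, hyT]
    have hr0 := (Real.sqrt_pos.2 (hne 0)).ne'
    have hcos : Real.cos (θ 0 + L) = Real.cos (θ 0) := by
      apply mul_left_cancel₀ hr0
      rw [← (hθ 0).1, ← hL 0, ← hr 0, ← (hθ (0 + T)).1, hXT]
    have hsin : Real.sin (θ 0 + L) = Real.sin (θ 0) := by
      apply mul_left_cancel₀ hr0
      rw [← (hθ 0).2, ← hL 0, ← hr 0, ← (hθ (0 + T)).2]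
      exact hyT 0
    have hang : ((θ 0 + L : ℝ) : Real.Angle) = (θ 0 : ℝ) :=
      Real.Angle.cos_sin_inj hcos hsin
    obtain ⟨k, hk⟩ := Real.Angle.angle_eq_iff_two_pi_dvd_sub.1 hang
    have hk' : L = k * (2 * Real.pi) := by linarith
    have hk0 : k ≠ 0 := by
      rintro rfl
      exact hL0 (by simpa using hk')
    refine ⟨k.natAbs, Int.natAbs_pos.2 hk0, ?_⟩
    rw [Nat.cast_natAbs, Int.cast_abs]
    rcases abs_choice (k : ℝ) with h | h
    · rw [h, ← hk']
      exact hpd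
    · rw [h, neg_mul, ← hk']
      exact hpd.neg
  · have hc : ∀ t, N.curve (fun s => E (σ s)) (θ t) = γ t := by
      intro t
      simp only [curve, hs2, hpos, hvel, hψX]
      rfl
    ext q
    constructor
    · rintro ⟨t, rfl⟩
      exact ⟨θ t, hc t⟩
    · rintro ⟨s, rfl⟩
      refine ⟨σ s, ?_⟩
      rw [← hc, hs1]

/-- A simple zero of the Melnikov integral gives rise to a limit cycle. -/
theorem exists_isLimitCycle (N : Annulus) (f : ℝ[X]) {h₀ m : ℝ} (hh : h₀ ∈ Ioo N.h₁ N.h₂)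
    (h0 : N.melnikov f h₀ = 0) (hm : HasDerivAt (N.melnikov f) m h₀) (hm0 : m ≠ 0) :
    ∃ ε₀ > 0, ∀ ε, 0 < ε → ε ≤ ε₀ →
      ∃ Γ, IsLimitCycle (lienard f (N.Q.comp N.P).derivative ε) Γ ∧ Γ ⊆ N.region := by
  obtain ⟨ε₁, hε₁, ha⟩ := exists_angular_pos N f
  obtain ⟨δ, hδ, hδ'⟩ : ∃ δ > 0, Icc (h₀ - δ) (h₀ + δ) ⊆ Ioo N.h₁ N.h₂ := by
    refine ⟨min (h₀ - N.h₁) (N.h₂ - h₀) / 2, half_pos (lt_min (sub_pos.2 hh.1) (sub_pos.2 hh.2)),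
      fun x hx => ?_⟩
    have h1 := min_le_left (h₀ - N.h₁) (N.h₂ - h₀)
    have h2 := min_le_right (h₀ - N.h₁) (N.h₂ - h₀)
    have := hh.1
    have := hh.2
    have := hx.1
    have := hx.2
    constructor <;> linarith
  obtain ⟨δ₀, hδ₀, hδ₀', ε₀, hε₀, hε₀', H⟩ := exists_unique_periodic_solution (R := N.rhs f)
    hδ hε₁ rhs_periodic (fun θ E hE ε hε => by
      have h1 := Ioo_subset_Icc_self (hδ' hE)
      refine contDiffAt_rhs h1.1 h1.2 (ha ε hε _ _ ?_)
      rw [energy_eq (N.lo_lt.le.trans h1.1)]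
      exact h1) h0 hm (hm.unique (hasDerivAt_melnikov hh)) hm0
  have hwin : Ioo (h₀ - δ₀) (h₀ + δ₀) ⊆ Ioo N.h₁ N.h₂ := fun x hx =>
    hδ' ⟨by linarith [hx.1], by linarith [hx.2]⟩
  have hwin' : Ioo (h₀ - δ₀) (h₀ + δ₀) ⊆ Icc N.h₁ N.h₂ := hwin.trans Ioo_subset_Icc_self
  refine ⟨ε₀, hε₀, fun ε hεp hε => ?_⟩
  obtain ⟨e, hper, he, hd, huniq⟩ := H ε hεp hε
  have ha' := ha ε (by rw [abs_of_pos hεp]; exact hε.trans hε₀')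
  have hsub : range (N.curve e) ⊆
      {p | p.1 ∈ N.I ∧ p.2 ^ 2 / 2 + (N.Q.comp N.P).eval p.1 ∈ Ioo (h₀ - δ₀) (h₀ + δ₀)} := by
    rintro _ ⟨θ, rfl⟩
    have := energy_curve (hwin' (he θ))
    refine ⟨this.1, ?_⟩
    rw [this.2]
    exact he θ
  refine ⟨range (N.curve e),
    ⟨isPeriodicOrbit_curve hper (fun θ => hwin' (he θ)) hd ha', _, ?_, hsub, fun Γ' hΓ' hs => ?_⟩,
    hsub.trans fun p hp => ⟨hp.1, hwin hp.2⟩⟩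
  · refine (N.isOpen_I.preimage continuous_fst).inter (isOpen_Ioo.preimage ?_)
    have := (N.Q.comp N.P).continuous
    fun_prop
  · obtain ⟨e', he', hd', ⟨k, hk, hkp⟩, rfl⟩ :=
      exists_periodic_solution_of_isPeriodicOrbit hwin' ha' hΓ' hs
    rw [huniq e' he' hd' k hk hkp]

end Annulus

theorem volume_image_eq_zero_of_deriv_eq_zero {φ : ℝ → ℝ} {s : Set ℝ}
    (h : ∀ x ∈ s, HasDerivAt φ 0 x) : volume (φ '' s) = 0 := by
  refine addHaar_image_eq_zero_of_det_fderivWithin_eq_zero volume (f' := fun _ => 0)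
    (fun x hx => ?_) fun x _ => by simp
  have := (h x hx).hasFDerivAt.hasFDerivWithinAt (s := s)
  simpa using this

namespace Annulus

theorem melnikov_add_C {N : Annulus} (f : ℝ[X]) (c : ℝ) {h : ℝ} (hh : h ∈ Icc N.h₁ N.h₂) :
    N.melnikov (f + C c) h = N.melnikov f h + c * N.melnikov 1 h := by
  rw [← mul_one (C c), melnikov_add hh, melnikov_C_mul]

/-- After adding a suitable constant to `f`, sign changes of finitely many Melnikov integrals
yield simple zeros. -/
theorem exists_simple_zeros {ι : Type*} [Finite ι] (N : ι → Annulus) (f : ℝ[X])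
    (hs : ∀ i, (N i).melnikov f (N i).h₁ * (N i).melnikov f (N i).h₂ < 0) :
    ∃ c : ℝ, ∀ i, ∃ h₀ ∈ Ioo (N i).h₁ (N i).h₂, (N i).melnikov (f + C c) h₀ = 0 ∧
      ∃ m, m ≠ 0 ∧ HasDerivAt ((N i).melnikov (f + C c)) m h₀ := by
  set φ : ι → ℝ → ℝ := fun i h => -((N i).melnikov f h / (N i).melnikov 1 h) with hφ
  set B : Set ℝ := ⋃ i, φ i '' {h | h ∈ Ioo (N i).h₁ (N i).h₂ ∧ HasDerivAt (φ i) 0 h} with hB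
  have hB0 : volume B = 0 := by
    have := Finite.to_countable (α := ι)
    exact measure_iUnion_null fun i => volume_image_eq_zero_of_deriv_eq_zero fun x hx => hx.2
  have hl : ∀ i, (N i).h₁ ∈ Icc (N i).h₁ (N i).h₂ := fun i => left_mem_Icc.2 (N i).lt.le
  have hr : ∀ i, (N i).h₂ ∈ Icc (N i).h₁ (N i).h₂ := fun i => right_mem_Icc.2 (N i).lt.le
  have hev : ∀ᶠ c in 𝓝 (0 : ℝ), ∀ i,
      ((N i).melnikov f (N i).h₁ + c * (N i).melnikov 1 (N i).h₁) *
        ((N i).melnikov f (N i).h₂ + c * (N i).melnikov 1 (N i).h₂) < 0 := by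
    rw [eventually_all]
    intro i
    have hc : Continuous fun c : ℝ => ((N i).melnikov f (N i).h₁ + c * (N i).melnikov 1 (N i).h₁) *
        ((N i).melnikov f (N i).h₂ + c * (N i).melnikov 1 (N i).h₂) := by fun_prop
    exact hc.continuousAt.eventually (gt_mem_nhds (by simpa using hs i))
  obtain ⟨c, hc, hcB⟩ : ∃ c, (∀ i,
      ((N i).melnikov f (N i).h₁ + c * (N i).melnikov 1 (N i).h₁) *
        ((N i).melnikov f (N i).h₂ + c * (N i).melnikov 1 (N i).h₂) < 0) ∧ c ∉ B := by
    by_contra! hcon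
    have h1 : B ∈ 𝓝 (0 : ℝ) := by
      filter_upwards [hev] with c hc using hcon c hc
    exact (Measure.measure_pos_of_mem_nhds volume h1).ne' hB0
  refine ⟨c, fun i => ?_⟩
  have hsign : (N i).melnikov (f + C c) (N i).h₁ * (N i).melnikov (f + C c) (N i).h₂ < 0 := by
    rw [melnikov_add_C f c (hl i), melnikov_add_C f c (hr i)]
    exact hc i
  obtain ⟨h₀, hh₀, hz⟩ : ∃ h₀ ∈ Ioo (N i).h₁ (N i).h₂, (N i).melnikov (f + C c) h₀ = 0 := by
    have hcont := continuousOn_melnikov (N := N i) (f := f + C c)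
    rcases mul_neg_iff.1 hsign with ⟨h1, h2⟩ | ⟨h1, h2⟩
    · exact intermediate_value_Ioo' (N i).lt.le hcont ⟨h2, h1⟩
    · exact intermediate_value_Ioo (N i).lt.le hcont ⟨h1, h2⟩
  refine ⟨h₀, hh₀, hz, ?_⟩
  have hh := Ioo_subset_Icc_self hh₀
  have hd := hasDerivAt_melnikov (f := f) hh₀
  have hd1 := hasDerivAt_melnikov (f := 1) hh₀
  have hd2 := hasDerivAt_melnikov (f := f + C c) hh₀
  set a := ∫ θ in (0 : ℝ)..2 * Real.pi, partialE ((N i).rhs f) (θ, h₀, 0)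
  set b := ∫ θ in (0 : ℝ)..2 * Real.pi, partialE ((N i).rhs 1) (θ, h₀, 0)
  set m := ∫ θ in (0 : ℝ)..2 * Real.pi, partialE ((N i).rhs (f + C c)) (θ, h₀, 0)
  have hm1 := melnikov_one_ne_zero hh
  have hm : m = a + c * b := by
    have h3 := hd.add (hd1.const_mul c)
    refine hd2.unique (h3.congr_of_eventuallyEq ?_)
    filter_upwards [Ioo_mem_nhds hh₀.1 hh₀.2] with h hh'
    exact melnikov_add_C f c (Ioo_subset_Icc_self hh')
  rw [melnikov_add_C f c hh] at hz
  refine ⟨m, fun hm0 => hcB ?_, hd2⟩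
  refine mem_iUnion.2 ⟨i, h₀, ⟨hh₀, ?_⟩, ?_⟩
  · refine (hd.div hd1 hm1).neg.congr_deriv ?_
    rw [neg_eq_zero, div_eq_zero_iff]
    left
    have h4 : (N i).melnikov f h₀ = -(c * (N i).melnikov 1 h₀) := by linarith
    rw [h4]
    have h5 : a = -(c * b) := by linarith
    rw [h5]
    ring
  · simp only [hφ]
    have h4 : (N i).melnikov f h₀ = -(c * (N i).melnikov 1 h₀) := by linarith
    rw [h4]
    field_simp

end Annulus

/-- Sign changes of Melnikov integrals on disjoint annuli bound the number of limit cycles. -/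
theorem hGe_of_annuli {n m : ℕ} {ι : Type*} [Fintype ι] (N : ι → Annulus) {f G : ℝ[X]}
    (hf : f.natDegree ≤ n) (hG : G.natDegree ≤ m + 1) (hN : ∀ i, (N i).Q.comp (N i).P = G)
    (hs : ∀ i, (N i).melnikov f (N i).h₁ * (N i).melnikov f (N i).h₂ < 0)
    (hdisj : Pairwise fun i j => Disjoint (N i).region (N j).region) :
    HGe n m (Fintype.card ι) := by
  obtain ⟨c, hc⟩ := Annulus.exists_simple_zeros N f hs
  have hlc : ∀ i, ∃ ε₀ > 0, ∀ ε, 0 < ε → ε ≤ ε₀ →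
      ∃ Γ, IsLimitCycle (lienard (f + C c) G.derivative ε) Γ ∧ Γ ⊆ (N i).region := by
    intro i
    obtain ⟨h₀, hh, h0, m, hm, hd⟩ := hc i
    rw [← hN i]
    exact (N i).exists_isLimitCycle _ hh h0 hd hm
  choose ε₀ hε₀ hΓ using hlc
  have hall : ∀ᶠ ε in 𝓝[>] (0 : ℝ), ∀ i, ε ≤ ε₀ i :=
    eventually_all.2 fun i => nhdsWithin_le_nhds (Iic_mem_nhds (hε₀ i))
  obtain ⟨ε₁, h1, h2⟩ := (hall.and self_mem_nhdsWithin).exists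
  refine ⟨f + C c, G.derivative, by simpa using hf,
    (natDegree_derivative_le G).trans (by omega), ε₁, h2, fun ε hε hle => ?_⟩
  choose Γ hΓ1 hΓ2 using fun i => hΓ i ε hε (hle.trans (h1 i))
  classical
  have hinj : Function.Injective Γ := by
    intro i j hij
    by_contra hne
    obtain ⟨γ, -, -, -, hγ⟩ := (hΓ1 i).1
    have hmem : γ 0 ∈ Γ i := hγ ▸ mem_range_self 0
    exact disjoint_left.1 (hdisj hne) (hΓ2 i hmem) (hΓ2 j (hij ▸ hmem))
  refine ⟨Finset.univ.image Γ, fun Γ' h' => ?_, ?_⟩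
  · obtain ⟨i, -, rfl⟩ := Finset.mem_image.1 h'
    exact hΓ1 i
  · rw [Finset.card_image_of_injective _ hinj, Finset.card_univ]

theorem Polynomial.tendsto_cocompact_atTop {q : ℝ[X]} (hd : 0 < q.natDegree)
    (he : Even q.natDegree) (hl : 0 < q.leadingCoeff) :
    Tendsto (fun x => q.eval x) (cocompact ℝ) atTop := by
  rw [cocompact_eq_atBot_atTop, tendsto_sup]
  refine ⟨?_, q.tendsto_atTop_of_leadingCoeff_nonneg (natDegree_pos_iff_degree_pos.1 hd) hl.le⟩
  have h1 : (q.comp (-X)).natDegree = q.natDegree := by simp [natDegree_comp]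
  have h2 : (q.comp (-X)).leadingCoeff = q.leadingCoeff := by
    rw [leadingCoeff_comp (by simp)]
    simp [he.neg_one_pow]
  have h3 := (q.comp (-X)).tendsto_atTop_of_leadingCoeff_nonneg
    (natDegree_pos_iff_degree_pos.1 (by rwa [h1])) (by rw [h2]; exact hl.le)
  refine (h3.comp tendsto_neg_atBot_atTop).congr fun x => ?_
  simp [eval_comp]

/-- The integral of `f y dx` along the level curve `y² / 2 + G x = h`. -/
noncomputable def levelIntegral (G f : ℝ[X]) (h : ℝ) : ℝ :=
  2 * ∫ x in -polarRadius G Real.pi h..polarRadius G 0 h, f.eval x * √(2 * (h - G.eval x))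

theorem levelIntegral_add_C_mul (G f g : ℝ[X]) (c h : ℝ) :
    levelIntegral G (f + C c * g) h = levelIntegral G f h + c * levelIntegral G g h := by
  have hc : ∀ q : ℝ[X], Continuous fun x => q.eval x * √(2 * (h - G.eval x)) := fun q =>
    q.continuous.mul (Real.continuous_sqrt.comp
      (continuous_const.mul (continuous_const.sub G.continuous)))
  simp only [levelIntegral, eval_add, eval_mul, eval_C, add_mul, mul_assoc]
  rw [intervalIntegral.integral_add ((hc f).intervalIntegrable _ _)
    (((hc g).const_mul c).intervalIntegrable _ _), intervalIntegral.integral_const_mul]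
  ring

theorem levelIntegral_of_odd {G f : ℝ[X]} (hG : ∀ x, G.eval (-x) = G.eval x)
    (hf : ∀ x, f.eval (-x) = -f.eval x) (h : ℝ) : levelIntegral G f h = 0 := by
  have h1 : polarRadius G Real.pi h = polarRadius G 0 h := by
    simpa using polarRadius_pi_sub hG 0 h
  have h2 := intervalIntegral.integral_comp_neg (a := -polarRadius G 0 h) (b := polarRadius G 0 h)
    fun x => f.eval x * √(2 * (h - G.eval x))
  simp only [hG, hf, neg_neg, neg_mul, intervalIntegral.integral_neg] at h2
  rw [levelIntegral, h1]
  linarith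

theorem StarAbove.polarRadius_axis {G : ℝ[X]} {h : ℝ} (hG : StarAbove G h) :
    (0 < polarRadius G 0 h ∧ G.eval (polarRadius G 0 h) = h) ∧
      0 < polarRadius G Real.pi h ∧ G.eval (-polarRadius G Real.pi h) = h := by
  have h1 := polarRadius_spec hG 0
  have h2 := polarRadius_spec hG Real.pi
  refine ⟨⟨h1.1, ?_⟩, h2.1, ?_⟩
  · simpa [polarEnergy] using h1.2
  · simpa [polarEnergy] using h2.2

theorem eventually_levelIntegral_pos {G f : ℝ[X]} {lo : ℝ} (hG : StarAbove G lo)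
    (hf : ∀ᶠ x in cocompact ℝ, 1 ≤ f.eval x) : ∀ᶠ h in atTop, 0 < levelIntegral G f h := by
  obtain ⟨r₀, hr₀, hr₀f⟩ : ∃ r > 0, ∀ x, r ≤ |x| → 1 ≤ f.eval x := by
    rw [cocompact_eq_atBot_atTop, eventually_sup] at hf
    obtain ⟨a, ha⟩ := eventually_atBot.1 hf.1
    obtain ⟨b, hb⟩ := eventually_atTop.1 hf.2
    refine ⟨max 1 (max (-a) b), by positivity, fun x hx => ?_⟩
    have h1 := (le_max_right 1 (max (-a) b)).trans hx
    rcases le_abs.1 ((le_max_right _ _).trans h1) with h | h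
    · exact hb x h
    · rcases le_abs.1 ((le_max_left _ _).trans h1) with h' | h'
      · rcases le_total 0 x with h0 | h0
        · have : b ≤ x := by
            have := (le_max_right (-a) b).trans h1
            rwa [abs_of_nonneg h0] at this
          exact hb x this
        · have : -a ≤ -x := by linarith
          exact ha x (by linarith)
      · exact ha x (by linarith)
  have hfi : ∀ a b, IntervalIntegrable (fun x => f.eval x) volume a b := fun a b =>
    f.continuous.intervalIntegrable _ _
  obtain ⟨r, hr, hri⟩ : ∃ r ≥ r₀, 0 < ∫ x in -r..r, f.eval x := by
    set c := ∫ x in -r₀..r₀, f.eval x with hc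
    refine ⟨r₀ + |c| + 1, by have := abs_nonneg c; linarith, ?_⟩
    set r := r₀ + |c| + 1
    have hrr : r₀ ≤ r := by have := abs_nonneg c; simp only [r]; linarith
    have e1 : ∫ x in -r..r, f.eval x =
        (∫ x in -r..-r₀, f.eval x) + c + ∫ x in r₀..r, f.eval x := by
      rw [intervalIntegral.integral_add_adjacent_intervals (hfi _ _) (hfi _ _),
        intervalIntegral.integral_add_adjacent_intervals (hfi _ _) (hfi _ _)]
    have e2 : r - r₀ ≤ ∫ x in r₀..r, f.eval x := by
      have := intervalIntegral.integral_mono_on (f := fun _ => (1 : ℝ)) (g := fun x => f.eval x)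
        hrr intervalIntegrable_const (hfi _ _) fun x hx =>
          hr₀f x (hx.1.trans (le_abs_self x))
      simpa using this
    have e3 : 0 ≤ ∫ x in -r..-r₀, f.eval x := by
      refine intervalIntegral.integral_nonneg (by linarith) fun x hx => ?_
      have h2 : r₀ ≤ |x| := by
        have := neg_le_abs x
        linarith [hx.2]
      linarith [hr₀f x h2]
    have : r - r₀ = |c| + 1 := by simp only [r]; ring
    have := neg_abs_le c
    linarith
  have hcont : Continuous fun s : ℝ => ∫ x in -r..r, f.eval x * √(2 * (1 - s * G.eval x)) := by
    refine intervalIntegral.continuous_parametric_intervalIntegral_of_continuous' ?_ _ _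
    have h1 : Continuous fun p : ℝ × ℝ => f.eval p.2 := f.continuous.comp continuous_snd
    have h2 : Continuous fun p : ℝ × ℝ => G.eval p.2 := G.continuous.comp continuous_snd
    exact (h1.mul (Real.continuous_sqrt.comp
      (continuous_const.mul (continuous_const.sub (continuous_fst.mul h2)))) :)
  have h0 : 0 < ∫ x in -r..r, f.eval x * √(2 * (1 - 0 * G.eval x)) := by
    simp only [zero_mul, sub_zero, intervalIntegral.integral_mul_const]
    positivity
  have hlim := (hcont.tendsto 0).comp tendsto_inv_atTop_zero
  obtain ⟨b, hb⟩ : ∃ b, ∀ x ∈ Icc (-r) r, G.eval x ≤ b := by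
    obtain ⟨b, hb⟩ := (isCompact_Icc (a := -r) (b := r)).bddAbove_image G.continuous.continuousOn
    exact ⟨b, fun x hx => hb (mem_image_of_mem _ hx)⟩
  filter_upwards [hlim.eventually (lt_mem_nhds h0), eventually_gt_atTop 0, eventually_gt_atTop b,
    eventually_ge_atTop lo] with h h1 hpos hhb hlo
  obtain ⟨⟨p1, p2⟩, p3, p4⟩ := (hG.mono hlo).polarRadius_axis
  set u := polarRadius G 0 h
  set v := polarRadius G Real.pi h
  have hu : r ≤ u := by
    by_contra! hcon
    linarith [hb u ⟨by linarith, hcon.le⟩]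
  have hv : r ≤ v := by
    by_contra! hcon
    linarith [hb (-v) ⟨by linarith, by linarith⟩]
  have hgi : ∀ a b, IntervalIntegrable (fun x => f.eval x * √(2 * (h - G.eval x))) volume a b :=
    fun a b => (f.continuous.mul (Real.continuous_sqrt.comp
      (continuous_const.mul (continuous_const.sub G.continuous)))).intervalIntegrable _ _
  have e1 : ∫ x in -v..u, f.eval x * √(2 * (h - G.eval x)) =
      (∫ x in -v..-r, f.eval x * √(2 * (h - G.eval x))) +
      (∫ x in -r..r, f.eval x * √(2 * (h - G.eval x))) +
      ∫ x in r..u, f.eval x * √(2 * (h - G.eval x)) := by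
    rw [intervalIntegral.integral_add_adjacent_intervals (hgi _ _) (hgi _ _),
      intervalIntegral.integral_add_adjacent_intervals (hgi _ _) (hgi _ _)]
  have e2 : 0 ≤ ∫ x in r..u, f.eval x * √(2 * (h - G.eval x)) := by
    refine intervalIntegral.integral_nonneg hu fun x hx => mul_nonneg ?_ (Real.sqrt_nonneg _)
    linarith [hr₀f x ((hr.le.trans hx.1).trans (le_abs_self x))]
  have e3 : 0 ≤ ∫ x in -v..-r, f.eval x * √(2 * (h - G.eval x)) := by
    refine intervalIntegral.integral_nonneg (by linarith) fun x hx =>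
      mul_nonneg ?_ (Real.sqrt_nonneg _)
    have h2 : r₀ ≤ |x| := by
      have := neg_le_abs x
      linarith [hx.2]
    linarith [hr₀f x h2]
  have e4 : ∫ x in -r..r, f.eval x * √(2 * (h - G.eval x)) =
      √h * ∫ x in -r..r, f.eval x * √(2 * (1 - h⁻¹ * G.eval x)) := by
    rw [← intervalIntegral.integral_const_mul]
    congr 1
    ext x
    have : 2 * (h - G.eval x) = h * (2 * (1 - h⁻¹ * G.eval x)) := by field_simp
    rw [this, Real.sqrt_mul hpos.le]
    ring
  have e5 : 0 < √h * ∫ x in -r..r, f.eval x * √(2 * (1 - h⁻¹ * G.eval x)) :=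
    mul_pos (Real.sqrt_pos.2 hpos) h1
  rw [levelIntegral, e1, e4]
  linarith

/-- There are polynomials of degree `2 K` whose level integrals change sign `K` times. -/
theorem exists_alternating {G : ℝ[X]} {lo : ℝ} (hG : StarAbove G lo) (hs : ℝ) (K : ℕ) :
    ∃ f : ℝ[X], f.natDegree ≤ 2 * K ∧ ∃ h : ℕ → ℝ, hs < h 0 ∧ (∀ k < K, h k < h (k + 1)) ∧
      ∀ k ≤ K, 0 < (-1) ^ k * levelIntegral G f (h k) := by
  induction K with
  | zero =>
    obtain ⟨h, h1, h2⟩ := ((eventually_levelIntegral_pos (f := 1) hG (by simp)).and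
      (eventually_gt_atTop hs)).exists
    exact ⟨1, by simp, fun _ => h, h2, by simp, fun k hk => by simpa [Nat.le_zero.1 hk] using h1⟩
  | succ K ih =>
    obtain ⟨f, hf, h, hh0, hh, hsign⟩ := ih
    have hev : ∀ᶠ δ in 𝓝 (0 : ℝ), ∀ k ∈ Finset.range (K + 1), 0 < (-1) ^ k *
        (levelIntegral G f (h k) +
          (-1) ^ (K + 1) * δ * levelIntegral G (X ^ (2 * K + 2)) (h k)) := by
      rw [eventually_all_finset]
      intro k hk
      have hc : Continuous fun δ : ℝ => (-1) ^ k * (levelIntegral G f (h k) +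
          (-1) ^ (K + 1) * δ * levelIntegral G (X ^ (2 * K + 2)) (h k)) := by fun_prop
      refine hc.continuousAt.eventually (lt_mem_nhds ?_)
      simpa using hsign k (Nat.lt_succ_iff.1 (Finset.mem_range.1 hk))
    obtain ⟨δ, hδ1, hδ⟩ := ((hev.filter_mono nhdsWithin_le_nhds).and
      (self_mem_nhdsWithin (a := (0 : ℝ)) (s := Ioi 0))).exists
    have hδ : 0 < δ := hδ
    set g : ℝ[X] := f + C ((-1) ^ (K + 1) * δ) * X ^ (2 * K + 2) with hg
    have hlarge : ∀ᶠ t in atTop, 0 < (-1) ^ (K + 1) * levelIntegral G g t := by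
      set q : ℝ[X] := C ((-1) ^ (K + 1)) * f + C δ * X ^ (2 * K + 2) with hq
      have hqdeg : (C ((-1) ^ (K + 1)) * f).degree < (C δ * X ^ (2 * K + 2) : ℝ[X]).degree := by
        rw [degree_C_mul_X_pow _ hδ.ne']
        refine (degree_le_of_natDegree_le ((natDegree_C_mul_le _ _).trans hf)).trans_lt ?_
        exact_mod_cast (by omega : 2 * K < 2 * K + 2)
      have hqev : ∀ᶠ x in cocompact ℝ, 1 ≤ q.eval x := by
        have h1 : q.natDegree = 2 * K + 2 := by
          rw [hq, natDegree_add_eq_right_of_degree_lt hqdeg, natDegree_C_mul_X_pow _ _ hδ.ne']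
        have h2 : q.leadingCoeff = δ := by
          rw [hq, leadingCoeff_add_of_degree_lt hqdeg, leadingCoeff_C_mul_X_pow]
        exact (tendsto_cocompact_atTop (by omega) (by rw [h1]; exact ⟨K + 1, by ring⟩)
          (h2 ▸ hδ)).eventually_ge_atTop 1
      have hpow : ((-1 : ℝ) ^ (K + 1)) * (-1) ^ (K + 1) = 1 := by
        rw [← mul_pow]; simp
      filter_upwards [eventually_levelIntegral_pos hG hqev] with t ht
      have h0 : levelIntegral G 0 t = 0 := by simp [levelIntegral]
      have e1 : levelIntegral G q t = (-1) ^ (K + 1) * levelIntegral G f t +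
          δ * levelIntegral G (X ^ (2 * K + 2)) t := by
        rw [hq, levelIntegral_add_C_mul, ← zero_add (C _ * f), levelIntegral_add_C_mul, h0,
          zero_add]
      rw [hg, levelIntegral_add_C_mul]
      rw [e1] at ht
      linear_combination ht - δ * levelIntegral G (X ^ (2 * K + 2)) t * hpow
    obtain ⟨t, ht1, ht2⟩ := (hlarge.and (eventually_gt_atTop (h K))).exists
    refine ⟨g, ?_, fun k => if k ≤ K then h k else t, by simpa using hh0, fun k hk => ?_,
      fun k hk => ?_⟩
    · refine natDegree_add_le_of_degree_le (hf.trans (by omega)) ?_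
      exact (natDegree_C_mul_X_pow_le _ _).trans (by omega)
    · rcases Nat.lt_succ_iff_lt_or_eq.1 hk with h1 | rfl
      · simp [h1.le, Nat.succ_le_of_lt h1, hh k h1]
      · simp [ht2]
    · rcases Nat.le_succ_iff.1 hk with h1 | rfl
      · simp only [h1, if_true]
        rw [hg, levelIntegral_add_C_mul]
        exact hδ1 k (Finset.mem_range.2 (by omega))
      · simpa using ht1

namespace Annulus

theorem rad_neg {N : Annulus} (θ h : ℝ) : N.rad (-θ) h = N.rad θ h := polarRadius_neg _ _ _

/-- With the identity as change of variable, the Melnikov integral is a level integral. -/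
theorem melnikov_eq_levelIntegral {N : Annulus} (hP : N.P = X) (hψ : N.ψ = id) (f : ℝ[X]) {h : ℝ}
    (hh : h ∈ Icc N.h₁ N.h₂) : N.melnikov f h = levelIntegral N.Q f h := by
  have hlo : N.lo < h := N.lo_lt.trans_le hh.1
  have hdamp : ∀ x, N.damping f x = f.eval x := fun x => by simp [damping, hP, hψ]
  have hXc : ContDiff ℝ 1 fun θ => N.pos θ h := by
    refine contDiff_iff_contDiffAt.2 fun θ => ContDiffAt.mul ?_ Real.contDiff_cos.contDiffAt
    have h1 : ContDiffAt ℝ 1 (fun θ : ℝ => (θ, h)) θ := by fun_prop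
    exact ContDiffAt.comp (f := fun θ : ℝ => (θ, h))
      (g := fun p : ℝ × ℝ => polarRadius N.Q p.1 p.2) θ (contDiffAt_polarRadius N.star hlo) h1
  have hder : ∀ θ, HasDerivAt (fun θ => N.pos θ h)
      (-(N.rad θ h ^ 2 / N.angular f (N.pos θ h) (N.vel θ h) 0) * N.vel θ h) θ := fun θ =>
    (hasDerivAt_pos_vel (f := f) (ε := 0) (e := fun _ => h) hh
      (by simpa using hasDerivAt_const θ h) (angular_zero hh.1)).1
  have hrhs : ∀ θ, N.rhs f (θ, h, 0) =
      -((f.eval (N.pos θ h) * N.vel θ h) * deriv (fun θ => N.pos θ h) θ) := by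
    intro θ
    rw [(hder θ).deriv, rhs, hdamp]
    ring
  have hvel : ∀ θ ∈ Icc 0 Real.pi, N.vel θ h = √(2 * (h - N.Q.eval (N.pos θ h))) := by
    intro θ hθ
    have h1 := energy_eq (θ := θ) hlo.le
    have h2 : 2 * (h - N.Q.eval (N.pos θ h)) = N.vel θ h ^ 2 := by linarith
    rw [h2, Real.sqrt_sq]
    exact mul_nonneg (rad_pos hlo.le).le (Real.sin_nonneg_of_mem_Icc hθ)
  have hcont := continuous_rhs_zero (f := f) hh
  have hsymm : ∫ θ in Real.pi..2 * Real.pi, N.rhs f (θ, h, 0) =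
      ∫ θ in (0 : ℝ)..Real.pi, N.rhs f (θ, h, 0) := by
    have h1 := intervalIntegral.integral_comp_sub_left (a := 0) (b := Real.pi)
      (fun θ => N.rhs f (θ, h, 0)) (2 * Real.pi)
    have h2 : ∀ θ, N.rhs f (2 * Real.pi - θ, h, 0) = N.rhs f (θ, h, 0) := by
      intro θ
      rw [sub_eq_neg_add, rhs_periodic]
      simp [rhs, angular, pos, vel, rad_neg]
    simp only [h2] at h1
    rw [h1]
    congr 1 <;> ring
  have hhalf : ∫ θ in (0 : ℝ)..Real.pi, N.rhs f (θ, h, 0) =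
      ∫ x in -polarRadius N.Q Real.pi h..polarRadius N.Q 0 h,
        f.eval x * √(2 * (h - N.Q.eval x)) := by
    have h1 := intervalIntegral.integral_comp_mul_deriv (a := 0) (b := Real.pi)
      (f := fun θ => N.pos θ h) (f' := deriv fun θ => N.pos θ h)
      (g := fun x => f.eval x * √(2 * (h - N.Q.eval x)))
      (fun θ _ => ((hder θ).differentiableAt).hasDerivAt)
      (hXc.continuous_deriv le_rfl).continuousOn
      (f.continuous.mul (Real.continuous_sqrt.comp
        (continuous_const.mul (continuous_const.sub N.Q.continuous))))
    have h2 : ∫ θ in (0 : ℝ)..Real.pi, N.rhs f (θ, h, 0) = -∫ θ in (0 : ℝ)..Real.pi,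
        ((fun x => f.eval x * √(2 * (h - N.Q.eval x))) ∘ fun θ => N.pos θ h) θ *
          deriv (fun θ => N.pos θ h) θ := by
      rw [← intervalIntegral.integral_neg]
      refine intervalIntegral.integral_congr fun θ hθ => ?_
      rw [uIcc_of_le Real.pi_pos.le] at hθ
      simp only [hrhs, Function.comp_apply, ← hvel θ hθ]
    rw [h2, h1, ← intervalIntegral.integral_symm]
    simp [pos, rad]
  rw [melnikov, ← intervalIntegral.integral_add_adjacent_intervals
    (hcont.intervalIntegrable 0 Real.pi) (hcont.intervalIntegrable Real.pi (2 * Real.pi)), hsymm,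
    hhalf, levelIntegral]
  ring

/-- The annulus of large closed level curves of a star-shaped energy. -/
theorem exists_outer {G : ℝ[X]} {lo h₁ h₂ : ℝ} (hG : StarAbove G lo) (h01 : lo < h₁)
    (h12 : h₁ < h₂) : ∃ N : Annulus, N.P = X ∧ N.Q = G ∧ N.h₁ = h₁ ∧ N.h₂ = h₂ ∧
      ∀ f, ∀ h ∈ Icc h₁ h₂, N.melnikov f h = levelIntegral G f h := by
  obtain ⟨L, hL⟩ : ∃ L : ℝ, ∀ x, G.eval x ≤ h₂ → |x| < L := by
    obtain ⟨K, hK, hK'⟩ := mem_cocompact.1 (hG.1.eventually_gt_atTop h₂)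
    obtain ⟨L, hL⟩ := hK.isBounded.exists_norm_le
    refine ⟨L + 1, fun x hx => ?_⟩
    have hxK : x ∈ K := by
      by_contra hxK
      exact absurd (hK' hxK) (not_lt.2 hx)
    exact (hL x hxK).trans_lt (lt_add_one L)
  let N : Annulus :=
    { P := X
      Q := G
      ψ := id
      I := Ioo (-L) L
      J := Ioo (-L) L
      lo := lo
      h₁ := h₁
      h₂ := h₂
      isOpen_I := isOpen_Ioo
      isOpen_J := isOpen_Ioo
      bdd := ⟨L, fun x hx => abs_lt.2 hx⟩
      mapsTo_P := by simp
      mapsTo_ψ := by simp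
      left_inv := by simp
      right_inv := by simp
      contDiffAt_ψ := fun x _ => contDiffAt_id
      sign := by simp
      lo_lt := h01
      lt := h12
      star := hG
      sub := fun x hx => abs_lt.1 (hL x hx) }
  exact ⟨N, rfl, rfl, rfl, rfl, fun f h hh => melnikov_eq_levelIntegral (N := N) rfl rfl f hh⟩

/-- Pulling an annulus back by one branch of the fold `u ↦ u² - a`. -/
theorem exists_fold (N : Annulus) {a s : ℝ} (ha : ∀ x ∈ N.I, |x| < a) (hs : s ^ 2 = 1) :
    ∃ N' : Annulus, N'.P = N.P.comp (X ^ 2 - C a) ∧ N'.Q = N.Q ∧ N'.h₁ = N.h₁ ∧ N'.h₂ = N.h₂ ∧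
      (∀ p ∈ N'.region, 0 < s * p.1 ∧ (p.1 ^ 2 - a, p.2) ∈ N.region) ∧
      ∀ f, ∀ h ∈ Icc N.h₁ N.h₂,
        N'.melnikov (C 2 * X * f.comp (X ^ 2 - C a)) h = N.melnikov f h := by
  have hpos : ∀ x ∈ N.J, 0 < N.ψ x + a := fun x hx => by
    have := (abs_lt.1 (ha _ (N.mapsTo_ψ x hx))).1
    linarith
  have hs0 : s ≠ 0 := by
    rintro rfl
    norm_num at hs
  have hsq : ∀ x ∈ N.J, (s * √(N.ψ x + a)) ^ 2 - a = N.ψ x := fun x hx => by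
    rw [mul_pow, hs, Real.sq_sqrt (hpos x hx).le]
    ring
  let N' : Annulus :=
    { P := N.P.comp (X ^ 2 - C a)
      Q := N.Q
      ψ := fun x => s * √(N.ψ x + a)
      I := {u | 0 < s * u ∧ u ^ 2 - a ∈ N.I}
      J := N.J
      lo := N.lo
      h₁ := N.h₁
      h₂ := N.h₂
      isOpen_I := by
        have h1 : IsOpen {u : ℝ | 0 < s * u} := isOpen_lt continuous_const (by fun_prop)
        have h2 : IsOpen ((fun u : ℝ => u ^ 2 - a) ⁻¹' N.I) := N.isOpen_I.preimage (by fun_prop)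
        exact h1.inter h2
      isOpen_J := N.isOpen_J
      bdd := by
        refine ⟨2 * a + 1, fun u hu => ?_⟩
        have h1 := abs_lt.1 (ha _ hu.2)
        have h2 : |u| ^ 2 < 2 * a := by rw [sq_abs]; linarith
        nlinarith [abs_nonneg u]
      mapsTo_P := fun u hu => by simpa [eval_comp] using N.mapsTo_P _ hu.2
      mapsTo_ψ := fun x hx => by
        refine ⟨?_, ?_⟩
        · rw [← mul_assoc, ← sq, hs, one_mul]
          exact Real.sqrt_pos.2 (hpos x hx)
        · rw [hsq x hx]
          exact N.mapsTo_ψ x hx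
      left_inv := fun u hu => by
        simp only [eval_comp, eval_sub, eval_pow, eval_X, eval_C]
        rw [N.left_inv _ hu.2, sub_add_cancel]
        have h1 : u ^ 2 = (s * u) ^ 2 := by rw [mul_pow, hs, one_mul]
        rw [h1, Real.sqrt_sq hu.1.le, ← mul_assoc, ← sq, hs, one_mul]
      right_inv := fun x hx => by
        simp only [eval_comp, eval_sub, eval_pow, eval_X, eval_C]
        rw [hsq x hx, N.right_inv x hx]
      contDiffAt_ψ := fun x hx =>
        contDiffAt_const.mul (((N.contDiffAt_ψ x hx).add contDiffAt_const).sqrt (hpos x hx).ne')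
      sign := by
        have key : ∀ u, s * u * N.P.derivative.eval (u ^ 2 - a) * 2 =
            s * (N.P.comp (X ^ 2 - C a)).derivative.eval u := fun u => by
          simp [derivative_comp, eval_comp]
          ring
        have h1 : ∀ t : ℝ, t = s * (s * t) := fun t => by rw [← mul_assoc, ← sq, hs, one_mul]
        have hs' : 0 < s ∨ s < 0 := (lt_or_gt_of_ne hs0).symm
        rcases hs' with hs' | hs' <;> rcases N.sign with h | h
        · left
          intro u hu
          rw [h1 ((N.P.comp _).derivative.eval u), ← key]
          have := h _ hu.2
          have := hu.1
          positivity
        · right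
          intro u hu
          rw [h1 ((N.P.comp _).derivative.eval u), ← key]
          have h3 := h _ hu.2
          exact mul_neg_of_pos_of_neg hs' (mul_neg_of_neg_of_pos
            (mul_neg_of_pos_of_neg hu.1 h3) two_pos)
        · right
          intro u hu
          rw [h1 ((N.P.comp _).derivative.eval u), ← key]
          have := h _ hu.2
          have := hu.1
          exact mul_neg_of_neg_of_pos hs' (by positivity)
        · left
          intro u hu
          rw [h1 ((N.P.comp _).derivative.eval u), ← key]
          have h3 := h _ hu.2
          exact mul_pos_of_neg_of_neg hs' (mul_neg_of_neg_of_pos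
            (mul_neg_of_pos_of_neg hu.1 h3) two_pos)
      lo_lt := N.lo_lt
      lt := N.lt
      star := N.star
      sub := N.sub }
  refine ⟨N', rfl, rfl, rfl, rfl, ?_, fun f h hh => ?_⟩
  · rintro ⟨u, y⟩ ⟨⟨h1, h2⟩, h3⟩
    refine ⟨h1, h2, ?_⟩
    have : (N.Q.comp (N.P.comp (X ^ 2 - C a))).eval u = (N.Q.comp N.P).eval (u ^ 2 - a) := by
      simp [eval_comp]
    change y ^ 2 / 2 + (N.Q.comp N.P).eval (u ^ 2 - a) ∈ _
    rw [← this]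
    exact h3
  · have hd : ∀ x ∈ N.J, N'.damping (C 2 * X * f.comp (X ^ 2 - C a)) x = N.damping f x := by
      intro x hx
      have h0 : s * √(N.ψ x + a) ≠ 0 := mul_ne_zero hs0 (Real.sqrt_pos.2 (hpos x hx)).ne'
      have h1 := deriv_ne_zero (N.mapsTo_ψ x hx)
      change (C 2 * X * f.comp (X ^ 2 - C a)).eval (s * √(N.ψ x + a)) /
        (N.P.comp (X ^ 2 - C a)).derivative.eval (s * √(N.ψ x + a)) = _
      simp only [derivative_comp, eval_mul, eval_comp, eval_sub, eval_pow, eval_X, eval_C,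
        derivative_sub, derivative_C, derivative_X_pow, hsq x hx, damping]
      generalize s * √(N.ψ x + a) = u at h0 ⊢
      simp only [Nat.cast_ofNat, Nat.add_one_sub_one, pow_one, eval_zero, sub_zero]
      field_simp
    refine intervalIntegral.integral_congr fun θ _ => ?_
    have hx : N.pos θ h ∈ N.J := pos_mem hh.1 hh.2
    have e1 : N'.pos θ h = N.pos θ h := rfl
    have e2 : N'.vel θ h = N.vel θ h := rfl
    have e3 : N'.rad θ h = N.rad θ h := rfl
    have e4 : N'.Q = N.Q := rfl
    simp only [rhs, angular, e1, e2, e3, e4, hd _ hx]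

/-- A family of disjoint concentric annuli and a polynomial of degree at most `2 K` whose Melnikov
integrals change sign on each of them. -/
theorem exists_outer_family {G : ℝ[X]} {lo : ℝ} (hG : StarAbove G lo) (hs : ℝ) (K : ℕ) :
    ∃ f : ℝ[X], f.natDegree ≤ 2 * K ∧ ∃ N : Fin K → Annulus,
      (∀ k, (N k).P = X ∧ (N k).Q = G) ∧
      (∀ k, (N k).melnikov f (N k).h₁ * (N k).melnikov f (N k).h₂ < 0) ∧
      (∀ k, ∀ g, ∀ h ∈ Icc (N k).h₁ (N k).h₂, (N k).melnikov g h = levelIntegral G g h) ∧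
      (∀ k, hs < (N k).h₁) ∧ Pairwise fun k l => Disjoint (N k).region (N l).region := by
  obtain ⟨f, hf, h, hh0, hlt, hsign⟩ := exists_alternating hG (max hs lo) K
  have hmono : ∀ l ≤ K, ∀ k ≤ l, h k ≤ h l := by
    intro l
    induction l with
    | zero => intro _ k hk; rw [Nat.le_zero.1 hk]
    | succ l ih =>
      intro hl k hk
      rcases Nat.le_succ_iff.1 hk with hk | rfl
      · exact (ih (by omega) k hk).trans (hlt l (by omega)).le
      · exact le_rfl
  have hgt : ∀ k ≤ K, max hs lo < h k := fun k hk => hh0.trans_le (hmono k hk 0 (Nat.zero_le _))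
  choose N hP hQ h1 h2 hM using fun k : Fin K =>
    exists_outer hG ((le_max_right hs lo).trans_lt (hgt k k.2.le)) (hlt k k.2)
  refine ⟨f, hf, N, fun k => ⟨hP k, hQ k⟩, fun k => ?_, fun k g t ht => ?_, fun k => ?_, ?_⟩
  · have hle := (hlt k k.2).le
    rw [h1, h2, hM k f _ (left_mem_Icc.2 hle), hM k f _ (right_mem_Icc.2 hle)]
    have e := mul_pos (hsign k k.2.le) (hsign (k + 1) k.2)
    have e3 : ((-1 : ℝ) ^ (k : ℕ)) * (-1) ^ (k : ℕ) = 1 := by rw [← mul_pow]; simp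
    rw [pow_succ] at e
    have e4 : (-1 : ℝ) ^ (k : ℕ) * levelIntegral G f (h k) *
        ((-1) ^ (k : ℕ) * -1 * levelIntegral G f (h (k + 1))) =
        -(((-1 : ℝ) ^ (k : ℕ)) * (-1) ^ (k : ℕ) *
          (levelIntegral G f (h k) * levelIntegral G f (h (k + 1)))) := by ring
    rw [e4, e3, one_mul] at e
    linarith
  · rw [h1, h2] at ht
    exact hM k g t ht
  · rw [h1]
    exact (le_max_left hs lo).trans_lt (hgt k k.2.le)
  · have key : ∀ k l : Fin K, k < l → Disjoint (N k).region (N l).region := by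
      intro k l hkl
      rw [disjoint_left]
      rintro p ⟨-, hp⟩ ⟨-, hp'⟩
      rw [hP, hQ, h1, h2] at hp hp'
      have := hmono l l.2.le (k + 1) hkl
      linarith [hp.2, hp'.1]
    intro k l hkl
    rcases lt_or_gt_of_ne hkl with h | h
    · exact key k l h
    · exact (key l k h).symm

end Annulus

/-- `n` is the degree of a damping with `c` sign changes on disjoint annuli of the potential `G`. -/
def Realizes (G : ℝ[X]) (n c : ℕ) : Prop :=
  ∃ f : ℝ[X], f.natDegree ≤ n ∧ ∃ (ι : Type) (_ : Fintype ι) (N : ι → Annulus),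
    Fintype.card ι = c ∧ (∀ i, (N i).Q.comp (N i).P = G) ∧
    (∀ i, (N i).melnikov f (N i).h₁ * (N i).melnikov f (N i).h₂ < 0) ∧
    Pairwise fun i j => Disjoint (N i).region (N j).region

theorem realizes_X_sq (n : ℕ) : Realizes (X ^ 2) n (n / 2) := by
  have hG : StarAbove (X ^ 2) 1 := by
    refine ⟨tendsto_cocompact_atTop (by simp) (by simp) (by simp), fun x => ?_⟩
    simp
    nlinarith
  obtain ⟨f, hf, N, hPQ, hM, -, -, hd⟩ := Annulus.exists_outer_family hG 0 (n / 2)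
  exact ⟨f, hf.trans (Nat.mul_div_le n 2), Fin (n / 2), inferInstance, N, by simp,
    fun i => by rw [(hPQ i).1, (hPQ i).2, comp_X], hM, hd⟩

theorem exists_starAbove {G : ℝ[X]} (hG : G.Monic) (hd : 2 < G.natDegree) (he : Even G.natDegree) :
    ∃ lo, StarAbove G lo := by
  set d := G.natDegree with hdef
  set q : ℝ[X] := X * G.derivative - C 2 * G with hq
  have hcoeff : q.coeff d = d - 2 := by
    obtain ⟨m, hm⟩ : ∃ m, d = m + 1 := ⟨d - 1, by omega⟩
    have h1 : G.coeff (m + 1) = 1 := by rw [← hm, hdef]; exact hG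
    rw [hq, coeff_sub, coeff_C_mul, hm, coeff_X_mul, coeff_derivative, h1]
    push_cast
    ring
  have hpos : (0 : ℝ) < d - 2 := by
    have : (2 : ℝ) < d := by exact_mod_cast hd
    linarith
  have hqd : q.natDegree = d := by
    refine natDegree_eq_of_le_of_coeff_ne_zero ?_ (by rw [hcoeff]; exact hpos.ne')
    refine (natDegree_sub_le _ _).trans (max_le ?_ (natDegree_C_mul_le _ _))
    refine natDegree_mul_le.trans ?_
    have := natDegree_derivative_le G
    rw [natDegree_X]
    omega
  have hql : q.leadingCoeff = d - 2 := by rw [leadingCoeff, hqd, hcoeff]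
  have ht := tendsto_cocompact_atTop (q := q) (by omega) (by rwa [hqd]) (by rwa [hql])
  obtain ⟨x₀, h₀⟩ := q.continuous.exists_forall_le ht
  refine ⟨(1 - q.eval x₀) / 2, tendsto_cocompact_atTop (by omega) he (by rw [hG]; exact one_pos),
    fun x => ?_⟩
  have h1 := h₀ x
  have h2 : q.eval x = x * G.derivative.eval x - 2 * G.eval x := by simp [hq]
  linarith

theorem Realizes.fold {G : ℝ[X]} {n c m : ℕ} (h : Realizes G n c) (hG : G.Monic)
    (hd : 2 ≤ G.natDegree) (hm : 2 * n + 1 ≤ m) :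
    ∃ G' : ℝ[X], G'.Monic ∧ G'.natDegree = 2 * G.natDegree ∧ Realizes G' m (2 * c + m / 2) := by
  obtain ⟨f, hf, ι, _, N, hcard, hNG, hM, hdisj⟩ := h
  obtain ⟨a, ha⟩ : ∃ a, ∀ i, ∀ x ∈ (N i).I, |x| < a := by
    choose B hB using fun i => (N i).bdd
    obtain ⟨a, ha⟩ := (finite_range B).bddAbove
    exact ⟨a, fun i x hx => (hB i x hx).trans_le (ha (mem_range_self i))⟩
  obtain ⟨hs, hhs⟩ : ∃ hs, ∀ i, (N i).h₂ ≤ hs := by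
    obtain ⟨b, hb⟩ := (finite_range fun i => (N i).h₂).bddAbove
    exact ⟨b, fun i => hb (mem_range_self i)⟩
  have hfold : (X ^ 2 - C a : ℝ[X]).natDegree = 2 := natDegree_X_pow_sub_C
  set G' := G.comp (X ^ 2 - C a) with hG'
  have hG'd : G'.natDegree = 2 * G.natDegree := by rw [hG', natDegree_comp, hfold, mul_comm]
  have hG'm : G'.Monic := hG.comp (monic_X_pow_sub_C a two_ne_zero) (by rw [hfold]; norm_num)
  have hG'e : ∀ x, G'.eval (-x) = G'.eval x := fun x => by simp [hG', eval_comp]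
  obtain ⟨lo, hlo⟩ := exists_starAbove hG'm (by omega) (by rw [hG'd]; exact even_two_mul _)
  obtain ⟨g, hg, O, hOPQ, hOM, hOl, hOh, hOd⟩ := Annulus.exists_outer_family hlo hs (m / 2)
  set F : ℝ[X] := C 2 * X * f.comp (X ^ 2 - C a) with hF
  have hFodd : ∀ x, F.eval (-x) = -F.eval x := fun x => by simp [hF, eval_comp]
  have hFd : F.natDegree ≤ m := by
    refine natDegree_mul_le.trans ?_
    have h1 : (C 2 * X : ℝ[X]).natDegree = 1 := natDegree_C_mul_X 2 two_ne_zero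
    rw [natDegree_comp, hfold]
    omega
  choose σ hσ hσ' using fun b : Bool => show ∃ s : ℝ, s ^ 2 = 1 ∧ s = cond b 1 (-1) by
    cases b <;> simp
  choose L hLP hLQ hL1 hL2 hLr hLm using fun q : ι × Bool =>
    Annulus.exists_fold (N q.1) (ha q.1) (hσ q.2)
  have hl : ∀ q : ι × Bool, (N q.1).h₁ ∈ Icc (N q.1).h₁ (N q.1).h₂ := fun q =>
    left_mem_Icc.2 (N q.1).lt.le
  have hr : ∀ q : ι × Bool, (N q.1).h₂ ∈ Icc (N q.1).h₁ (N q.1).h₂ := fun q =>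
    right_mem_Icc.2 (N q.1).lt.le
  have hLadd : ∀ q : ι × Bool, ∀ h ∈ Icc (N q.1).h₁ (N q.1).h₂, ∀ δ,
      (L q).melnikov (F + C δ * g) h =
        (N q.1).melnikov f h + δ * (L q).melnikov g h := fun q h hh δ => by
    rw [Annulus.melnikov_add (by rwa [hL1, hL2]), Annulus.melnikov_C_mul, hLm q f h hh]
  obtain ⟨δ, hδ, hδ0⟩ : ∃ δ : ℝ, (∀ q, (L q).melnikov (F + C δ * g) (L q).h₁ *
      (L q).melnikov (F + C δ * g) (L q).h₂ < 0) ∧ 0 < δ := by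
    have hev : ∀ᶠ δ in 𝓝 (0 : ℝ), ∀ q, (L q).melnikov (F + C δ * g) (L q).h₁ *
        (L q).melnikov (F + C δ * g) (L q).h₂ < 0 := by
      rw [eventually_all]
      intro q
      simp only [hL1, hL2, hLadd q _ (hl q), hLadd q _ (hr q)]
      have hc : Continuous fun δ : ℝ =>
          ((N q.1).melnikov f (N q.1).h₁ + δ * (L q).melnikov g (N q.1).h₁) *
          ((N q.1).melnikov f (N q.1).h₂ + δ * (L q).melnikov g (N q.1).h₂) := by fun_prop
      exact hc.continuousAt.eventually (gt_mem_nhds (by simpa using hM q.1))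
    exact ((hev.filter_mono nhdsWithin_le_nhds).and
      (self_mem_nhdsWithin : Ioi (0 : ℝ) ∈ 𝓝[>] 0)).exists
  have hLG : ∀ q, (L q).Q.comp (L q).P = G' := fun q => by
    rw [hLQ, hLP, ← comp_assoc, hNG]
  have hOG : ∀ k, (O k).Q.comp (O k).P = G' := fun k => by
    rw [(hOPQ k).1, (hOPQ k).2, comp_X]
  have hLO : ∀ q k, Disjoint (L q).region (O k).region := fun q k => by
    rw [disjoint_left]
    rintro p ⟨-, hp⟩ ⟨-, hp'⟩
    rw [hLG, hL1, hL2] at hp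
    rw [hOG] at hp'
    linarith [hp.2, hp'.1, hhs q.1, hOh k]
  refine ⟨G', hG'm, hG'd, F + C δ * g, natDegree_add_le_of_degree_le hFd
    ((natDegree_C_mul_le _ _).trans (by omega)), (ι × Bool) ⊕ Fin (m / 2), inferInstance,
    Sum.elim L O, by simp [hcard, mul_comm], ?_, ?_, ?_⟩
  · rintro (q | k)
    · exact hLG q
    · exact hOG k
  · rintro (q | k)
    · exact hδ q
    · have hle := (O k).lt.le
      change (O k).melnikov _ (O k).h₁ * (O k).melnikov _ (O k).h₂ < 0
      have h1 := hOM k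
      rw [hOl k _ _ (left_mem_Icc.2 hle), hOl k _ _ (right_mem_Icc.2 hle)] at h1 ⊢
      rw [levelIntegral_add_C_mul, levelIntegral_add_C_mul, levelIntegral_of_odd hG'e hFodd,
        levelIntegral_of_odd hG'e hFodd]
      nlinarith [mul_pos hδ0 hδ0]
  · rintro (⟨i, b⟩ | k) (⟨j, b'⟩ | l) hne
    · change Disjoint (L (i, b)).region (L (j, b')).region
      rw [disjoint_left]
      intro p hp hp'
      obtain ⟨h1, h2⟩ := hLr _ p hp
      obtain ⟨h3, h4⟩ := hLr _ p hp'
      by_cases hij : i = j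
      · subst hij
        rw [hσ'] at h1 h3
        cases b <;> cases b' <;> simp at hne h1 h3 <;> linarith
      · exact disjoint_left.1 (hdisj hij) h2 h4
    · exact hLO _ _
    · exact (hLO _ _).symm
    · exact hOd fun h => hne (by rw [h])

/-- Existence of the configurations, with the count of the lower bound. -/
theorem exists_realizes (p : ℕ) : ∀ n : ℕ, 2 ^ (p + 1) - 1 ≤ n → ∃ G : ℝ[X], G.Monic ∧
    G.natDegree = 2 ^ (p + 1) ∧ ∃ c : ℕ, Realizes G n c ∧
      ((p : ℝ) + 1) * n / 2 - (((p : ℝ) + 4) * 2 ^ p / 2 - ((p : ℝ) + 1)) ≤ c := by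
  induction p with
  | zero =>
    intro n _
    refine ⟨X ^ 2, monic_X_pow 2, by simp, n / 2, realizes_X_sq n, ?_⟩
    have h1 : n ≤ 2 * (n / 2) + 1 := by omega
    have h2 : (n : ℝ) ≤ 2 * ((n / 2 : ℕ) : ℝ) + 1 := by exact_mod_cast h1
    norm_num
    linarith
  | succ p ih =>
    intro n hn
    have hpow : 2 ^ (p + 1 + 1) = 2 * 2 ^ (p + 1) := by ring
    have hpow1 : 1 ≤ 2 ^ (p + 1) := Nat.one_le_two_pow
    have hpow2 : 2 ^ (p + 1) = 2 * 2 ^ p := by ring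
    have hpow3 : 1 ≤ 2 ^ p := Nat.one_le_two_pow
    obtain ⟨G, hG, hGd, c, hc, hcle⟩ := ih ((n - 1) / 2) (by omega)
    obtain ⟨G', hG', hGd', hR⟩ := hc.fold (m := n) hG (by omega) (by omega)
    refine ⟨G', hG', by rw [hGd', hGd, hpow], _, hR, ?_⟩
    have h2p : (1 : ℝ) ≤ 2 ^ p := one_le_pow₀ (by norm_num)
    set k := (n - 1) / 2 with hk
    have hp0 : (0 : ℝ) ≤ p := Nat.cast_nonneg p
    rcases (by omega : n = 2 * k + 1 ∨ n = 2 * k + 2) with h | h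
    · have h2 : n / 2 = k := by omega
      rw [h2, h]
      push_cast
      rw [pow_succ]
      nlinarith
    · have h2 : n / 2 = k + 1 := by omega
      rw [h2, h]
      push_cast
      rw [pow_succ]
      nlinarith

theorem stmt2 (p j n : ℕ) (hp : 1 ≤ p) (hj1 : 1 ≤ j) (hj2 : j ≤ 2 ^ p)
    (hn : 2 ^ (p + 1) - 1 ≤ n) :
    HGe n (2 ^ (p + 1) - 2 + j)
      (((p : ℝ) + 1) * n / 2 - (((p : ℝ) + 4) * 2 ^ (p - 1) - ((p : ℝ) + 1))) := by
  obtain ⟨G, -, hGd, c, ⟨f, hf, ι, _, N, hcard, hNG, hM, hd⟩, hc⟩ := exists_realizes p n hn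
  have h1 : 1 ≤ 2 ^ p := Nat.one_le_two_pow
  have h2 : 2 ^ (p + 1) = 2 * 2 ^ p := by ring
  obtain ⟨f', g', hf', hg', ε₀, hε₀, H⟩ :=
    hGe_of_annuli (m := 2 ^ (p + 1) - 2 + j) N hf (by omega) hNG hM hd
  refine ⟨f', g', hf', hg', ε₀, hε₀, fun ε hε hle => ?_⟩
  obtain ⟨S, hS, hcS⟩ := H ε hε hle
  refine ⟨S, hS, le_trans ?_ hcS⟩
  rw [hcard]
  obtain ⟨q, rfl⟩ : ∃ q, p = q + 1 := ⟨p - 1, by omega⟩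
  refine le_trans (le_of_eq ?_) hc
  rw [Nat.add_sub_cancel, pow_succ]
  ring
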